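/- Let u, v : ℝ^n → ℝ be lower semicontinuous, Lebesgue-integrable functions such that ∫_{ℝ^n} u(x) dx > 0 and ∫_{ℝ^n} v(x) dx > 0. Then there exist points a, b ∈ ℝ^n and an affine function l on ℝ that is strictly positive on (0,1) such that ∫_0^1 u((1-t)a + t b) · l(t)^{n-1} dt > 0 and ∫_0^1 v((1-t)a + t b) · l(t)^{n-1} dt > 0. -/

import Mathlib

open MeasureTheory Set

/-- The weighted geometric mean `(a ^ n * b) ^ (1 / (n + 1))` of two concave functions is concave,
stated on a single convex combination. -/
theorem geomMean_concave (n : ℕ) {a₁ a₂ a b₁ b₂ b s t : ℝ} (ha₁ : 0 < a₁) (ha₂ : 0 < a₂)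
    (hb₁ : 0 < b₁) (hb₂ : 0 < b₂) (hs : 0 ≤ s) (ht : 0 ≤ t) (hst : s + t = 1)
    (ha : s * a₁ + t * a₂ ≤ a) (hb : s * b₁ + t * b₂ ≤ b) :
    s * (a₁ ^ n * b₁) ^ ((n : ℝ) + 1)⁻¹ + t * (a₂ ^ n * b₂) ^ ((n : ℝ) + 1)⁻¹ ≤
      (a ^ n * b) ^ ((n : ℝ) + 1)⁻¹ := by
  have pos_comb : ∀ {p q : ℝ}, 0 < p → 0 < q → 0 < s * p + t * q := by
    intro p q hp hq
    rcases hs.eq_or_lt with rfl | hs'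
    · have : t = 1 := by linarith
      subst this; linarith
    · have := mul_pos hs' hp
      have := mul_nonneg ht hq.le
      linarith
  set X := s * a₁ + t * a₂ with hX
  set Y := s * b₁ + t * b₂ with hY
  have hX0 : 0 < X := pos_comb ha₁ ha₂
  have hY0 : 0 < Y := pos_comb hb₁ hb₂
  set r : ℝ := ((n : ℝ) + 1)⁻¹ with hr
  have hr0 : 0 < r := by positivity
  have hnr : n * r + r = 1 := by rw [hr]; field_simp
  set G := (X ^ n * Y) ^ r with hG
  have hG0 : 0 < G := by positivity
  have key : ∀ {p q : ℝ}, 0 < p → 0 < q →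
      (p ^ n * q) ^ r ≤ G * (n * r * (p / X) + r * (q / Y)) := by
    intro p q hp hq
    have h1 := Real.geom_mean_le_arith_mean2_weighted (w₁ := n * r) (w₂ := r) (p₁ := p / X)
      (p₂ := q / Y) (by positivity) hr0.le (by positivity) (by positivity) hnr
    have h2 : (p / X) ^ (n * r) * (q / Y) ^ r * G = (p ^ n * q) ^ r := by
      rw [hG, Real.rpow_mul (by positivity), Real.rpow_natCast,
        ← Real.mul_rpow (by positivity) (by positivity),
        ← Real.mul_rpow (by positivity) (by positivity)]
      congr 1
      rw [div_pow]
      field_simp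
    rw [← h2, mul_comm]
    gcongr
  calc s * (a₁ ^ n * b₁) ^ r + t * (a₂ ^ n * b₂) ^ r
      ≤ s * (G * (n * r * (a₁ / X) + r * (b₁ / Y))) +
        t * (G * (n * r * (a₂ / X) + r * (b₂ / Y))) := by
        gcongr
        · exact key ha₁ hb₁
        · exact key ha₂ hb₂
    _ = G * (n * r * (X / X) + r * (Y / Y)) := by rw [hX, hY]; ring
    _ = G := by rw [div_self hX0.ne', div_self hY0.ne', mul_one, mul_one, hnr, mul_one]
    _ ≤ (a ^ n * b) ^ r := by
        have := hX0.trans_le ha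
        rw [hG]; gcongr

/-- Two linear equations in three unknowns have a nontrivial solution. -/
theorem exists_ne_zero_of_two_equations (a b : Fin 3 → ℝ) :
    ∃ v : Fin 3 → ℝ, v ≠ 0 ∧ ∑ i, a i * v i = 0 ∧ ∑ i, b i * v i = 0 := by
  have h := LinearMap.ker_ne_bot_of_finrank_lt (K := ℝ) (f := Matrix.toLin' !![a 0, a 1, a 2;
    b 0, b 1, b 2]) (by simp)
  obtain ⟨v, hv, hv0⟩ := Submodule.exists_mem_ne_zero_of_ne_bot h
  rw [LinearMap.mem_ker, Matrix.toLin'_apply] at hv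
  refine ⟨v, hv0, ?_, ?_⟩
  · simpa [Matrix.mulVec, dotProduct, Fin.sum_univ_three] using congrFun hv 0
  · simpa [Matrix.mulVec, dotProduct, Fin.sum_univ_three] using congrFun hv 1

/-- Discrete localization on a finite set of reals: a positive weight whose `(n+1)`-st root is
concave may be replaced by the `(n+1)`-st power of an affine function on a subinterval. -/
theorem exists_affine_pow_weight_of_sum_pos {ι : Type*} [Fintype ι] (n : ℕ) (x : ι → ℝ)
    (hx : Function.Injective x) (f g φ : ι → ℝ) (hφ : ∀ i, 0 < φ i)
    (hconc : ∀ i j k s t, 0 ≤ s → 0 ≤ t → s + t = 1 → x j = s * x i + t * x k →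
      s * φ i + t * φ k ≤ φ j)
    (hf : 0 < ∑ i, f i * φ i ^ (n + 1)) (hg : 0 < ∑ i, g i * φ i ^ (n + 1)) :
    ∃ (c d : ℝ) (S : Finset ι), S.Nonempty ∧ (∀ i ∈ S, 0 < c + d * x i) ∧
      (∀ i ∈ S, ∀ k ∈ S, ∀ j, x i ≤ x j → x j ≤ x k → j ∈ S) ∧
      0 ≤ ∑ i ∈ S, f i * (c + d * x i) ^ (n + 1) ∧
      0 ≤ ∑ i ∈ S, g i * (c + d * x i) ^ (n + 1) := by
  classical
  set r : ℝ := ((n : ℝ) + 1)⁻¹ with hr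
  have hr0 : 0 < r := by positivity
  have root_pow : ∀ {y : ℝ}, 0 ≤ y → (y ^ (n + 1)) ^ r = y := by
    intro y hy
    rw [← Real.rpow_natCast, ← Real.rpow_mul hy, hr]
    push_cast
    rw [mul_inv_cancel₀ (by positivity), Real.rpow_one]
  have pow_root : ∀ {y : ℝ}, 0 ≤ y → (y ^ r) ^ (n + 1) = y := by
    intro y hy
    rw [← Real.rpow_natCast, ← Real.rpow_mul hy, hr]
    push_cast
    rw [inv_mul_cancel₀ (by positivity), Real.rpow_one]
  -- the compact set of admissible normalized weights
  let V : Set (ι → ℝ) := {w | (∀ i, 0 ≤ w i) ∧ ∑ i, w i = 1 ∧ 0 ≤ ∑ i, f i * w i ∧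
    ∀ i j k s t, 0 ≤ s → 0 ≤ t → s + t = 1 → x j = s * x i + t * x k →
      w i = 0 ∨ w k = 0 ∨ s * w i ^ r + t * w k ^ r ≤ w j ^ r}
  have hVclosed : IsClosed V := by
    have hroot : ∀ i, Continuous fun w : ι → ℝ => w i ^ r := fun i =>
      (continuous_apply i).rpow_const fun _ => Or.inr hr0.le
    simp only [V, ofPred_and, ofPred_forall, ofPred_or]
    refine (isClosed_iInter fun i => isClosed_le continuous_const (continuous_apply i)).inter
      ((isClosed_eq (by fun_prop) continuous_const).inter
      ((isClosed_le continuous_const (by fun_prop)).inter ?_))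
    refine isClosed_iInter fun i => isClosed_iInter fun j => isClosed_iInter fun k =>
      isClosed_iInter fun s => isClosed_iInter fun t => isClosed_iInter fun _ =>
      isClosed_iInter fun _ => isClosed_iInter fun _ => isClosed_iInter fun _ => ?_
    exact (isClosed_eq (continuous_apply i) continuous_const).union
      ((isClosed_eq (continuous_apply k) continuous_const).union
      (isClosed_le (((hroot i).const_mul s).add ((hroot k).const_mul t)) (hroot j)))
  have hVcompact : IsCompact V := by
    refine (isCompact_Icc (a := (0 : ι → ℝ)) (b := 1)).of_isClosed_subset hVclosed ?_
    rintro w ⟨hw0, hw1, -⟩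
    refine ⟨fun i => hw0 i, fun i => ?_⟩
    rw [Pi.one_apply, ← hw1]
    exact Finset.single_le_sum (fun i _ => hw0 i) (Finset.mem_univ i)
  -- the initial weight
  have hι : Nonempty ι := by
    by_contra h
    rw [not_nonempty_iff] at h
    simp at hf
  set Z := ∑ i, φ i ^ (n + 1) with hZ
  have hZ0 : 0 < Z := Finset.sum_pos (fun i _ => pow_pos (hφ i) _) Finset.univ_nonempty
  have sum_div : ∀ h : ι → ℝ, ∑ i, h i * (φ i ^ (n + 1) / Z) = (∑ i, h i * φ i ^ (n + 1)) / Z := by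
    intro h
    rw [Finset.sum_div]
    exact Finset.sum_congr rfl fun i _ => by ring
  have hw₀ : (fun i => φ i ^ (n + 1) / Z) ∈ V := by
    refine ⟨fun i => by have := hφ i; positivity, ?_, ?_, ?_⟩
    · rw [← Finset.sum_div, div_self hZ0.ne']
    · rw [sum_div]; positivity
    · intro i j k s t hs ht hst hxj
      refine Or.inr (Or.inr ?_)
      simp only [Real.div_rpow (pow_nonneg (hφ _).le _) hZ0.le, root_pow (hφ _).le]
      have := hconc i j k s t hs ht hst hxj
      have hZr : 0 < Z ^ r := by positivity
      calc s * (φ i / Z ^ r) + t * (φ k / Z ^ r) = (s * φ i + t * φ k) / Z ^ r := by ring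
        _ ≤ φ j / Z ^ r := by gcongr
  set κ := (∑ i, g i * φ i ^ (n + 1)) / Z with hκ
  have hκ0 : 0 < κ := by positivity
  -- maximize a strictly convex functional
  obtain ⟨w, hwV, hwmax⟩ := hVcompact.exists_isMaxOn ⟨_, hw₀⟩
    (f := fun w : ι → ℝ => ∑ i, g i * w i + κ * ∑ i, w i ^ 2) (by fun_prop)
  obtain ⟨hw0, hw1, hwf, hwc⟩ := id hwV
  have hwg : 0 ≤ ∑ i, g i * w i := by
    have h1 := hwmax hw₀
    simp only [mem_ofPred_eq, sum_div] at h1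
    have h2 : ∑ i, w i ^ 2 ≤ 1 := by
      rw [← hw1]
      refine Finset.sum_le_sum fun i _ => ?_
      have : w i ≤ 1 := by
        rw [← hw1]; exact Finset.single_le_sum (fun i _ => hw0 i) (Finset.mem_univ i)
      nlinarith [hw0 i]
    have h3 : 0 ≤ κ * ∑ i, (φ i ^ (n + 1) / Z) ^ 2 := by positivity
    nlinarith
  set S : Finset ι := Finset.univ.filter fun i => 0 < w i with hS
  have hSw : ∀ i, i ∈ S ↔ 0 < w i := by simp [hS]
  have hSne : S.Nonempty := by
    by_contra h
    rw [Finset.not_nonempty_iff_eq_empty] at h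
    have : ∀ i, w i = 0 := fun i => by
      have : i ∉ S := by simp [h]
      rw [hSw] at this
      exact le_antisymm (not_lt.1 this) (hw0 i)
    simp [this] at hw1
  have hSsum : ∀ h : ι → ℝ, ∑ i, h i * w i = ∑ i ∈ S, h i * w i := by
    intro h
    refine (Finset.sum_subset (Finset.subset_univ S) fun i _ hi => ?_).symm
    rw [hSw] at hi
    rw [le_antisymm (not_lt.1 hi) (hw0 i), mul_zero]
  set ψ : ι → ℝ := fun i => w i ^ r with hψ
  have hψ0 : ∀ i ∈ S, 0 < ψ i := fun i hi => Real.rpow_pos_of_pos ((hSw i).1 hi) _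
  have hψw : ∀ i, ψ i ^ (n + 1) = w i := fun i => pow_root (hw0 i)
  have hψc : ∀ i ∈ S, ∀ k ∈ S, ∀ j s t, 0 ≤ s → 0 ≤ t → s + t = 1 → x j = s * x i + t * x k →
      s * ψ i + t * ψ k ≤ ψ j := by
    intro i hi k hk j s t hs ht hst hxj
    rcases hwc i j k s t hs ht hst hxj with h | h | h
    · exact absurd h ((hSw i).1 hi).ne'
    · exact absurd h ((hSw k).1 hk).ne'
    · exact h
  have comb_pos : ∀ {s t p q : ℝ}, 0 ≤ s → 0 ≤ t → s + t = 1 → 0 < p → 0 < q →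
      0 < s * p + t * q := by
    intro s t p q hs ht hst hp hq
    rcases hs.eq_or_lt with rfl | hs'
    · have : t = 1 := by linarith
      subst this; linarith
    · have := mul_pos hs' hp
      have := mul_nonneg ht hq.le
      linarith
  have hSc : ∀ i ∈ S, ∀ k ∈ S, ∀ j s t, 0 ≤ s → 0 ≤ t → s + t = 1 → x j = s * x i + t * x k →
      j ∈ S := by
    intro i hi k hk j s t hs ht hst hxj
    have h1 := hψc i hi k hk j s t hs ht hst hxj
    have h2 := comb_pos hs ht hst (hψ0 i hi) (hψ0 k hk)
    rw [hSw, ← hψw]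
    exact pow_pos (h2.trans_le h1) _
  have hSconv : ∀ i ∈ S, ∀ k ∈ S, ∀ j, x i ≤ x j → x j ≤ x k → j ∈ S := by
    intro i hi k hk j hij hjk
    obtain ⟨s, t, hs, ht, hst, h⟩ : x j ∈ segment ℝ (x i) (x k) := by
      rw [segment_eq_Icc (hij.trans hjk)]; exact ⟨hij, hjk⟩
    exact hSc i hi k hk j s t hs ht hst (by simpa using h.symm)
  -- an admissible first-order perturbation
  obtain ⟨v, hv0, hvm, hvf⟩ := exists_ne_zero_of_two_equations
    ![∑ i ∈ S, ψ i ^ n, ∑ i ∈ S, ψ i ^ n * x i, ∑ i ∈ S, ψ i ^ n * ψ i]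
    ![∑ i ∈ S, f i * ψ i ^ n, ∑ i ∈ S, f i * (ψ i ^ n * x i), ∑ i ∈ S, f i * (ψ i ^ n * ψ i)]
  set η : ι → ℝ := fun i => v 0 + v 1 * x i + v 2 * ψ i with hη
  have hηm : ∑ i ∈ S, ψ i ^ n * η i = 0 := by
    rw [← hvm]
    simp only [Fin.sum_univ_three, Matrix.cons_val_zero, Matrix.cons_val_one, Matrix.cons_val,
      Finset.sum_mul, ← Finset.sum_add_distrib]
    exact Finset.sum_congr rfl fun i _ => by simp only [hη]; ring
  have hηf : ∑ i ∈ S, f i * (ψ i ^ n * η i) = 0 := by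
    rw [← hvf]
    simp only [Fin.sum_univ_three, Matrix.cons_val_zero, Matrix.cons_val_one, Matrix.cons_val,
      Finset.sum_mul, ← Finset.sum_add_distrib]
    exact Finset.sum_congr rfl fun i _ => by simp only [hη]; ring
  have hη0 : ∀ i ∈ S, η i = 0 := by
    by_contra! hne
    obtain ⟨i₀, hi₀, hne⟩ := hne
    obtain ⟨δ, hδ0, hδ⟩ : ∃ δ : ℝ, 0 < δ ∧ ∀ ε, |ε| ≤ δ →
        0 ≤ 1 + ε * v 2 ∧ ∀ i ∈ S, 0 < ψ i + ε * η i := by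
      have h1 : ∀ᶠ ε in nhds (0 : ℝ), 0 ≤ 1 + ε * v 2 ∧ ∀ i ∈ S, 0 < ψ i + ε * η i := by
        refine Filter.Eventually.and ?_ ?_
        · have : Filter.Tendsto (fun ε : ℝ => 1 + ε * v 2) (nhds 0) (nhds (1 + 0 * v 2)) :=
            Continuous.tendsto (by fun_prop) 0
          exact (this.eventually (lt_mem_nhds (by norm_num : (0 : ℝ) < 1 + 0 * v 2))).mono
            fun _ h => le_of_lt h
        · rw [Filter.eventually_all_finset]
          intro i hi
          have : Filter.Tendsto (fun ε : ℝ => ψ i + ε * η i) (nhds 0) (nhds (ψ i + 0 * η i)) :=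
            Continuous.tendsto (by fun_prop) 0
          exact this.eventually (lt_mem_nhds (by simpa using hψ0 i hi))
      obtain ⟨δ, hδ, h⟩ := Metric.eventually_nhds_iff.1 h1
      refine ⟨δ / 2, by positivity, fun ε hε => h ?_⟩
      rw [Real.dist_eq, sub_zero]; linarith
    let W : ℝ → ι → ℝ := fun ε i => if i ∈ S then ψ i ^ n * (ψ i + ε * η i) else 0
    have hWsum : ∀ ε (h : ι → ℝ), ∑ i, h i * W ε i =
        ∑ i, h i * w i + ε * ∑ i ∈ S, h i * (ψ i ^ n * η i) := by
      intro ε h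
      rw [hSsum, Finset.mul_sum, ← Finset.sum_add_distrib, ← Finset.sum_subset
        (Finset.subset_univ S) (f := fun i => h i * W ε i) (by intro i _ hi; simp [W, hi])]
      refine Finset.sum_congr rfl fun i hi => ?_
      simp only [W, hi, if_true, ← hψw i]
      ring
    have hWV : ∀ ε, |ε| ≤ δ → W ε ∈ V := by
      intro ε hε
      obtain ⟨h1, h2⟩ := hδ ε hε
      refine ⟨fun i => ?_, ?_, ?_, ?_⟩
      · by_cases hi : i ∈ S
        · have := h2 i hi
          have := hψ0 i hi
          simp only [W, hi, if_true]; positivity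
        · simp [W, hi]
      · have := hWsum ε fun _ => 1
        simpa [hw1, hηm] using this
      · rw [hWsum, hηf]; simpa using hwf
      · intro i j k s t hs ht hst hxj
        by_cases hi : i ∈ S
        swap
        · left; simp [W, hi]
        by_cases hk : k ∈ S
        swap
        · right; left; simp [W, hk]
        right; right
        have hj := hSc i hi k hk j s t hs ht hst hxj
        simp only [W, hi, hj, hk, if_true]
        have h3 := hψc i hi k hk j s t hs ht hst hxj
        refine geomMean_concave n (hψ0 i hi) (hψ0 k hk) (h2 i hi) (h2 k hk) hs ht hst h3 ?_
        have e : ∀ i, ψ i + ε * η i = (1 + ε * v 2) * ψ i + ε * v 0 + ε * v 1 * x i := by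
          intro i; simp only [hη]; ring
        rw [e, e, e, hxj]
        have h4 := mul_le_mul_of_nonneg_left h3 h1
        have h5 : s * (ε * v 0) + t * (ε * v 0) = ε * v 0 := by rw [← add_mul, hst, one_mul]
        nlinarith
    have hmax1 := hwmax (hWV δ (by rw [abs_of_pos hδ0]))
    have hmax2 := hwmax (hWV (-δ) (by rw [abs_neg, abs_of_pos hδ0]))
    simp only [mem_ofPred_eq, hWsum] at hmax1 hmax2
    have hsq : ∑ i, W δ i ^ 2 + ∑ i, W (-δ) i ^ 2 =
        2 * ∑ i, w i ^ 2 + 2 * δ ^ 2 * ∑ i ∈ S, (ψ i ^ n * η i) ^ 2 := by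
      have e1 : ∀ ε, ∑ i, W ε i ^ 2 = ∑ i ∈ S, (ψ i ^ n * (ψ i + ε * η i)) ^ 2 := by
        intro ε
        rw [← Finset.sum_subset (Finset.subset_univ S) (f := fun i => W ε i ^ 2)
          (by intro i _ hi; simp [W, hi])]
        exact Finset.sum_congr rfl fun i hi => by simp [W, hi]
      have e2 : ∑ i, w i ^ 2 = ∑ i ∈ S, w i ^ 2 := by
        have := hSsum w
        simpa only [← pow_two] using this
      rw [e1, e1, e2, Finset.mul_sum, Finset.mul_sum, ← Finset.sum_add_distrib,
        ← Finset.sum_add_distrib]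
      refine Finset.sum_congr rfl fun i _ => ?_
      rw [← hψw i]; ring
    have hpos : 0 < ∑ i ∈ S, (ψ i ^ n * η i) ^ 2 := by
      refine Finset.sum_pos' (fun i _ => sq_nonneg _) ⟨i₀, hi₀, ?_⟩
      have := hψ0 i₀ hi₀
      positivity
    have hpos2 : 0 < κ * (2 * δ ^ 2 * ∑ i ∈ S, (ψ i ^ n * η i) ^ 2) := by positivity
    have := congrArg (κ * ·) hsq
    simp only [mul_add] at this
    linarith
  -- hence the weight is the power of an affine function
  obtain ⟨c, d, hcd⟩ : ∃ c d : ℝ, ∀ i ∈ S, ψ i = c + d * x i := by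
    by_cases h2 : v 2 = 0
    · by_cases h1 : v 1 = 0
      · exfalso
        obtain ⟨i, hi⟩ := hSne
        have h := hη0 i hi
        simp only [hη, h1, h2, zero_mul, add_zero] at h
        exact hv0 (by ext j; fin_cases j <;> simp [h, h1, h2])
      · obtain ⟨i, hi⟩ := hSne
        refine ⟨ψ i, 0, fun j hj => ?_⟩
        have hi' := hη0 i hi
        have hj' := hη0 j hj
        simp only [hη, h2, zero_mul, add_zero] at hi' hj'
        have : x j = x i := mul_left_cancel₀ h1 (by linarith)
        rw [hx this]; ring
    · refine ⟨-v 0 / v 2, -v 1 / v 2, fun i hi => ?_⟩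
      have h := hη0 i hi
      simp only [hη] at h
      field_simp
      linarith
  have hfin : ∀ h : ι → ℝ, ∑ i ∈ S, h i * (c + d * x i) ^ (n + 1) = ∑ i, h i * w i := by
    intro h
    rw [hSsum]
    exact Finset.sum_congr rfl fun i hi => by rw [← hcd i hi, hψw]
  refine ⟨c, d, S, hSne, fun i hi => hcd i hi ▸ hψ0 i hi, hSconv, ?_, ?_⟩
  · rwa [hfin]
  · rwa [hfin]

/-- Error estimate for left Riemann sums on `[0, 1]`. -/
theorem abs_integral_sub_riemannSum_le {H : ℝ → ℝ} (hH : Continuous H) {L : ℕ} (hL : 0 < L) {η : ℝ}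
    (hη : ∀ x ∈ Icc (0 : ℝ) 1, ∀ y ∈ Icc (0 : ℝ) 1, |x - y| ≤ 1 / L → |H x - H y| ≤ η) :
    |(∫ s in (0 : ℝ)..1, H s) - 1 / L * ∑ j ∈ Finset.range L, H (j / L)| ≤ η := by
  have hL' : (0 : ℝ) < L := by exact_mod_cast hL
  have hsum : ∑ j ∈ Finset.range L, ∫ s in ((j : ℝ) / L)..((j + 1 : ℕ) : ℝ) / L, H s =
      ∫ s in (0 : ℝ)..1, H s := by
    rw [intervalIntegral.sum_integral_adjacent_intervals (a := fun j : ℕ => (j : ℝ) / L)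
      fun k _ => hH.intervalIntegrable _ _]
    simp [div_self hL'.ne']
  have hlen : ∀ j : ℕ, ((j + 1 : ℕ) : ℝ) / L - (j : ℝ) / L = 1 / L := by
    intro j; push_cast; ring
  have hterm : ∀ j ∈ Finset.range L,
      |(∫ s in ((j : ℝ) / L)..((j + 1 : ℕ) : ℝ) / L, H s) - 1 / L * H (j / L)| ≤ η * (1 / L) := by
    intro j hj
    have hj' : ((j + 1 : ℕ) : ℝ) ≤ L := by exact_mod_cast Finset.mem_range.1 hj
    have hle : (j : ℝ) / L ≤ ((j + 1 : ℕ) : ℝ) / L := by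
      have := hlen j; have : 0 < 1 / (L : ℝ) := by positivity
      linarith
    have h1 : ((j + 1 : ℕ) : ℝ) / L ≤ 1 := (div_le_one hL').2 hj'
    have h0 : 0 ≤ (j : ℝ) / L := by positivity
    have e : (∫ s in ((j : ℝ) / L)..((j + 1 : ℕ) : ℝ) / L, H s) - 1 / L * H (j / L) =
        ∫ s in ((j : ℝ) / L)..((j + 1 : ℕ) : ℝ) / L, (H s - H (j / L)) := by
      rw [intervalIntegral.integral_sub (hH.intervalIntegrable _ _) (by simp),
        intervalIntegral.integral_const, hlen, smul_eq_mul]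
    have hlen' := hlen j
    rw [e, ← Real.norm_eq_abs]
    refine (intervalIntegral.norm_integral_le_of_norm_le_const (C := η) fun s hs => ?_).trans ?_
    · rw [uIoc_of_le hle] at hs
      rw [Real.norm_eq_abs]
      refine hη s ⟨h0.trans hs.1.le, hs.2.trans h1⟩ _ ⟨h0, hle.trans h1⟩ ?_
      rw [abs_of_nonneg (by linarith [hs.1])]
      linarith [hs.2]
    · rw [hlen', abs_of_pos (by positivity)]
  calc _ = |∑ j ∈ Finset.range L, ((∫ s in ((j : ℝ) / L)..((j + 1 : ℕ) : ℝ) / L, H s) -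
        1 / L * H (j / L))| := by rw [Finset.sum_sub_distrib, hsum, Finset.mul_sum]
    _ ≤ ∑ j ∈ Finset.range L, η * (1 / L) :=
        (Finset.abs_sum_le_sum_abs _ _).trans (Finset.sum_le_sum hterm)
    _ = η := by rw [Finset.sum_const, Finset.card_range, nsmul_eq_mul]; field_simp

theorem abs_pow_sub_pow_le_of_mem_Icc {a b : ℝ} (ha : a ∈ Icc (0 : ℝ) 1)
    (hb : b ∈ Icc (0 : ℝ) 1) (N : ℕ) :
    |a ^ N - b ^ N| ≤ N * |a - b| := by
  induction N with
  | zero => simp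
  | succ N ih =>
    have e : a ^ (N + 1) - b ^ (N + 1) = a * (a ^ N - b ^ N) + (a - b) * b ^ N := by ring
    rw [e]
    refine (abs_add_le _ _).trans ?_
    rw [abs_mul, abs_mul, abs_of_nonneg ha.1, abs_of_nonneg (pow_nonneg hb.1 N)]
    have h1 : a * |a ^ N - b ^ N| ≤ 1 * |a ^ N - b ^ N| :=
      mul_le_mul_of_nonneg_right ha.2 (abs_nonneg _)
    have h2 : |a - b| * b ^ N ≤ |a - b| * 1 :=
      mul_le_mul_of_nonneg_left (pow_le_one₀ hb.1 hb.2) (abs_nonneg _)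
    push_cast
    linarith

theorem one_div_le_integral_affine_pow {p q : ℝ} (hp : 0 < p) (hq : 0 < q) (hpq : p = 1 ∨ q = 1)
    (N : ℕ) : 1 / ((N : ℝ) + 1) ≤ ∫ s in (0 : ℝ)..1, (p + (q - p) * s) ^ N := by
  have hc : Continuous fun s : ℝ => (p + (q - p) * s) ^ N := by fun_prop
  rcases hpq with rfl | rfl
  · have e : ∫ s in (0 : ℝ)..1, (1 - s) ^ N = 1 / ((N : ℝ) + 1) := by
      rw [intervalIntegral.integral_comp_sub_left (fun s => s ^ N) 1]
      simp
    rw [← e]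
    refine intervalIntegral.integral_mono_on zero_le_one
      (Continuous.intervalIntegrable (by fun_prop) _ _) (hc.intervalIntegrable _ _) fun s hs => ?_
    exact pow_le_pow_left₀ (by linarith [hs.2]) (by nlinarith [hs.1]) N
  · have e : ∫ s in (0 : ℝ)..1, s ^ N = 1 / ((N : ℝ) + 1) := by simp
    rw [← e]
    refine intervalIntegral.integral_mono_on zero_le_one
      (Continuous.intervalIntegrable (by fun_prop) _ _) (hc.intervalIntegrable _ _) fun s hs => ?_
    exact pow_le_pow_left₀ hs.1 (by nlinarith [hs.2]) N

/-- A nonnegative discrete needle sum with slack `ε` gives a positive needle integral once the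
mesh is fine enough. -/
theorem integral_affine_pow_pos_of_sum_nonneg (N : ℕ) {h : ℝ → ℝ} (hh : Continuous h) {α β : ℝ}
    (hαβ : α ≤ β) {L : ℕ} (hL : 0 < L) {p q : ℝ} (hp : 0 < p) (hq : 0 < q) (hp1 : p ≤ 1)
    (hq1 : q ≤ 1) (hpq : p = 1 ∨ q = 1) {B ε ε' : ℝ} (hε : 0 < ε)
    (hB : ∀ x ∈ Icc α β, |h x| ≤ B)
    (hosc : ∀ x ∈ Icc α β, ∀ y ∈ Icc α β, |x - y| ≤ (β - α) / L → |h x - h y| ≤ ε')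
    (hsum : 0 ≤ ∑ j ∈ Finset.range (L + 1),
      (h (α + (β - α) * (j / L)) - ε) * (p + (q - p) * (j / L)) ^ N)
    (hsmall : ε' + (B + ε) * (N + 1) / L < ε / (N + 1)) :
    0 < ∫ s in (0 : ℝ)..1, h (α + (β - α) * s) * (p + (q - p) * s) ^ N := by
  have hL' : (0 : ℝ) < L := by exact_mod_cast hL
  set H : ℝ → ℝ := fun s => (h (α + (β - α) * s) - ε) * (p + (q - p) * s) ^ N with hH
  have hHc : Continuous H := by fun_prop
  have hx : ∀ s ∈ Icc (0 : ℝ) 1, α + (β - α) * s ∈ Icc α β := fun s hs =>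
    ⟨by nlinarith [hs.1], by nlinarith [hs.2]⟩
  have hk : ∀ s ∈ Icc (0 : ℝ) 1, p + (q - p) * s ∈ Icc (0 : ℝ) 1 := fun s hs =>
    ⟨by nlinarith [hs.1, hs.2], by nlinarith [hs.1, hs.2]⟩
  have hB0 : 0 ≤ B := (abs_nonneg _).trans (hB α ⟨le_rfl, hαβ⟩)
  have hbd : ∀ s ∈ Icc (0 : ℝ) 1, |h (α + (β - α) * s) - ε| ≤ B + ε := fun s hs => by
    refine (abs_sub _ _).trans ?_
    rw [abs_of_pos hε]
    linarith [hB _ (hx s hs)]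
  have hmod : ∀ x ∈ Icc (0 : ℝ) 1, ∀ y ∈ Icc (0 : ℝ) 1, |x - y| ≤ 1 / L →
      |H x - H y| ≤ ε' + (B + ε) * (N * (1 / L)) := by
    intro s hs t ht hst
    have e : H s - H t = (h (α + (β - α) * s) - h (α + (β - α) * t)) * (p + (q - p) * s) ^ N +
        (h (α + (β - α) * t) - ε) * ((p + (q - p) * s) ^ N - (p + (q - p) * t) ^ N) := by
      simp only [hH]; ring
    rw [e]
    refine (abs_add_le _ _).trans ?_
    rw [abs_mul, abs_mul]
    have h1 : |h (α + (β - α) * s) - h (α + (β - α) * t)| ≤ ε' := by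
      refine hosc _ (hx s hs) _ (hx t ht) ?_
      rw [show α + (β - α) * s - (α + (β - α) * t) = (β - α) * (s - t) by ring, abs_mul,
        abs_of_nonneg (by linarith)]
      calc (β - α) * |s - t| ≤ (β - α) * (1 / L) := by
            apply mul_le_mul_of_nonneg_left hst; linarith
        _ = _ := by ring
    have h2 : |(p + (q - p) * s) ^ N| ≤ 1 := by
      rw [abs_of_nonneg (pow_nonneg (hk s hs).1 N)]
      exact pow_le_one₀ (hk s hs).1 (hk s hs).2
    have h3 : |(p + (q - p) * s) ^ N - (p + (q - p) * t) ^ N| ≤ N * (1 / L) := by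
      refine (abs_pow_sub_pow_le_of_mem_Icc (hk s hs) (hk t ht) N).trans ?_
      have : |p + (q - p) * s - (p + (q - p) * t)| ≤ 1 / L := by
        rw [show p + (q - p) * s - (p + (q - p) * t) = (q - p) * (s - t) by ring, abs_mul]
        have : |q - p| ≤ 1 := abs_le.2 ⟨by linarith, by linarith⟩
        calc |q - p| * |s - t| ≤ 1 * |s - t| :=
              mul_le_mul_of_nonneg_right this (abs_nonneg _)
          _ ≤ _ := by rwa [one_mul]
      exact mul_le_mul_of_nonneg_left this (Nat.cast_nonneg _)
    have h4 : |h (α + (β - α) * s) - h (α + (β - α) * t)| * |(p + (q - p) * s) ^ N| ≤ ε' * 1 :=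
      mul_le_mul h1 h2 (abs_nonneg _) ((abs_nonneg _).trans h1)
    have h5 := mul_le_mul (hbd t ht) h3 (abs_nonneg _) (by linarith)
    linarith
  have hR := (abs_le.1 (abs_integral_sub_riemannSum_le hHc hL hmod)).1
  have hlast : H 1 ≤ B + ε := by
    have h1 : (1 : ℝ) ∈ Icc (0 : ℝ) 1 := ⟨zero_le_one, le_rfl⟩
    refine (le_abs_self _).trans ?_
    simp only [hH]
    rw [abs_mul]
    have h2 : |(p + (q - p) * 1) ^ N| ≤ 1 := by
      rw [abs_of_nonneg (pow_nonneg (hk 1 h1).1 N)]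
      exact pow_le_one₀ (hk 1 h1).1 (hk 1 h1).2
    calc _ ≤ (B + ε) * 1 := mul_le_mul (hbd 1 h1) h2 (abs_nonneg _) (by linarith)
      _ = _ := mul_one _
  have hsum' : -(B + ε) / L ≤ 1 / L * ∑ j ∈ Finset.range L, H (j / L) := by
    rw [Finset.sum_range_succ, div_self hL'.ne'] at hsum
    have : -(B + ε) ≤ ∑ j ∈ Finset.range L, H (j / L) := by
      change 0 ≤ ∑ j ∈ Finset.range L, H (j / L) + H 1 at hsum
      linarith
    calc -(B + ε) / L = 1 / L * -(B + ε) := by ring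
      _ ≤ _ := by gcongr
  have hint : ∫ s in (0 : ℝ)..1, H s =
      (∫ s in (0 : ℝ)..1, h (α + (β - α) * s) * (p + (q - p) * s) ^ N) -
        ε * ∫ s in (0 : ℝ)..1, (p + (q - p) * s) ^ N := by
    rw [← intervalIntegral.integral_const_mul, ← intervalIntegral.integral_sub
      (Continuous.intervalIntegrable (by fun_prop) _ _)
      (Continuous.intervalIntegrable (by fun_prop) _ _)]
    simp only [hH, sub_mul]
  have hlow := mul_le_mul_of_nonneg_left (one_div_le_integral_affine_pow hp hq hpq N) hε.le
  rw [mul_one_div] at hlow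
  have e : (B + ε) * (N + 1) / L = (B + ε) * (N * (1 / L)) - -(B + ε) / L := by ring
  linarith

theorem Continuous.exists_modulus_Icc {H : ℝ → ℝ} (hH : Continuous H) {η : ℝ} (hη : 0 < η) :
    ∃ δ > 0, ∀ x ∈ Icc (0 : ℝ) 1, ∀ y ∈ Icc (0 : ℝ) 1, |x - y| ≤ δ → |H x - H y| ≤ η := by
  have huc := isCompact_Icc.uniformContinuousOn_of_continuous
    (hH.continuousOn (s := Icc (0 : ℝ) 1))
  obtain ⟨δ, hδ, h⟩ := Metric.uniformContinuousOn_iff_le.1 huc η hη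
  exact ⟨δ, hδ, fun x hx y hy hxy => h x hx y hy hxy⟩

theorem eventually_riemannSum_pos {H : ℝ → ℝ} (hH : Continuous H)
    (hpos : 0 < ∫ s in (0 : ℝ)..1, H s) :
    ∀ᶠ M : ℕ in Filter.atTop, 0 < ∑ j ∈ Finset.range M, H (j / M) := by
  obtain ⟨δ, hδ, h⟩ := hH.exists_modulus_Icc (half_pos hpos)
  filter_upwards [tendsto_one_div_atTop_nhds_zero_nat.eventually (gt_mem_nhds hδ),
    Filter.eventually_gt_atTop 0] with M hM hM0
  have := (abs_le.1 (abs_integral_sub_riemannSum_le hH hM0 fun x hx y hy hxy =>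
    h x hx y hy (hxy.trans hM.le))).2
  have hM' : (0 : ℝ) < 1 / M := by positivity
  exact pos_of_mul_pos_right (by linarith) hM'.le

/-- Natural-number indexed form of `exists_affine_pow_weight_of_sum_pos` on an equispaced grid. -/
theorem exists_affine_pow_weight_grid (n : ℕ) {M : ℕ} (hM : 0 < M) {f g φ : ℝ → ℝ}
    (hφ : ∀ s ∈ Icc (0 : ℝ) 1, 0 < φ s) (hconc : ConcaveOn ℝ (Icc 0 1) φ)
    (hf : 0 < ∑ j ∈ Finset.range M, f (j / M) * φ (j / M) ^ (n + 1))
    (hg : 0 < ∑ j ∈ Finset.range M, g (j / M) * φ (j / M) ^ (n + 1)) :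
    ∃ (c d : ℝ) (i L : ℕ), i + L < M ∧ (∀ j ≤ L, 0 < c + d * (((i + j : ℕ) : ℝ) / M)) ∧
      0 ≤ ∑ j ∈ Finset.range (L + 1), f (((i + j : ℕ) : ℝ) / M) *
        (c + d * (((i + j : ℕ) : ℝ) / M)) ^ (n + 1) ∧
      0 ≤ ∑ j ∈ Finset.range (L + 1), g (((i + j : ℕ) : ℝ) / M) *
        (c + d * (((i + j : ℕ) : ℝ) / M)) ^ (n + 1) := by
  have hM' : (0 : ℝ) < M := by exact_mod_cast hM
  have hmem : ∀ i : Fin M, ((i : ℕ) : ℝ) / M ∈ Icc (0 : ℝ) 1 := fun i =>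
    ⟨by positivity, (div_le_one hM').2 (by exact_mod_cast i.2.le)⟩
  have hinj : Function.Injective fun i : Fin M => ((i : ℕ) : ℝ) / M := by
    intro i j hij
    have : ((i : ℕ) : ℝ) = ((j : ℕ) : ℝ) := (div_left_inj' hM'.ne').1 hij
    exact Fin.ext (by exact_mod_cast this)
  rw [Finset.sum_range] at hf hg
  obtain ⟨c, d, S, hne, hpos, hS, h1, h2⟩ := exists_affine_pow_weight_of_sum_pos n
    (fun i : Fin M => ((i : ℕ) : ℝ) / M) hinj (fun i => f ((i : ℕ) / M)) (fun i => g ((i : ℕ) / M))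
    (fun i => φ ((i : ℕ) / M)) (fun i => hφ _ (hmem i))
    (fun i j k s t hs ht hst hj => by
      have := hconc.2 (hmem i) (hmem k) hs ht hst
      simp only [smul_eq_mul] at this
      rwa [← hj] at this) hf hg
  set i₀ := S.min' hne
  set i₁ := S.max' hne
  have hle : (i₀ : ℕ) ≤ i₁ := S.min'_le_max' hne
  have hmono : ∀ i j : Fin M, i ≤ j → ((i : ℕ) : ℝ) / M ≤ ((j : ℕ) : ℝ) / M := fun i j hij =>
    div_le_div_of_nonneg_right (by exact_mod_cast hij) hM'.le
  have hmap : S.map Fin.valEmbedding = Finset.Ico (i₀ : ℕ) (i₁ + 1) := by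
    ext m
    simp only [Finset.mem_map, Fin.valEmbedding_apply, Finset.mem_Ico]
    constructor
    · rintro ⟨i, hi, rfl⟩
      exact ⟨S.min'_le i hi, Nat.lt_succ_of_le (S.le_max' i hi)⟩
    · rintro ⟨ha, hb⟩
      have hm : m < M := by have := i₁.2; omega
      refine ⟨⟨m, hm⟩, hS _ (S.min'_mem hne) _ (S.max'_mem hne) _ (hmono _ _ ?_) (hmono _ _ ?_),
        rfl⟩
      · exact ha
      · exact Nat.le_of_lt_succ hb
  have hsum : ∀ F : ℕ → ℝ, ∑ i ∈ S, F i = ∑ j ∈ Finset.range (i₁ - i₀ + 1), F (i₀ + j) := by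
    intro F
    have : ∑ i ∈ S, F i = ∑ m ∈ S.map Fin.valEmbedding, F m := by
      rw [Finset.sum_map]; rfl
    rw [this, hmap, Finset.sum_Ico_eq_sum_range, Nat.sub_add_comm hle]
  refine ⟨c, d, i₀, i₁ - i₀, by have := i₁.2; omega, fun j hj => ?_, ?_, ?_⟩
  · have : (i₀ : ℕ) + j ∈ S.map Fin.valEmbedding := by
      rw [hmap, Finset.mem_Ico]; omega
    obtain ⟨i, hi, hi'⟩ := Finset.mem_map.1 this
    have := hpos i hi
    rw [← hi']
    exact this
  · rw [← hsum fun m => f ((m : ℝ) / M) * (c + d * ((m : ℝ) / M)) ^ (n + 1)]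
    exact h1
  · rw [← hsum fun m => g ((m : ℝ) / M) * (c + d * ((m : ℝ) / M)) ^ (n + 1)]
    exact h2

theorem exists_slack_of_integral_mul_pos {f w : ℝ → ℝ} (hf : Continuous f) (hw : Continuous w)
    (hw0 : ∀ s ∈ Icc (0 : ℝ) 1, 0 ≤ w s) (hpos : 0 < ∫ s in (0 : ℝ)..1, f s * w s) :
    ∃ ε > 0, ∀ ε' ≤ ε, 0 < ∫ s in (0 : ℝ)..1, (f s - ε') * w s := by
  set F := ∫ s in (0 : ℝ)..1, f s * w s
  set I := ∫ s in (0 : ℝ)..1, w s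
  have hI : 0 ≤ I := intervalIntegral.integral_nonneg zero_le_one hw0
  refine ⟨F / (I + 1), by positivity, fun ε' hε' => ?_⟩
  have e : ∫ s in (0 : ℝ)..1, (f s - ε') * w s = F - ε' * I := by
    simp only [sub_mul]
    rw [intervalIntegral.integral_sub (Continuous.intervalIntegrable (by fun_prop) _ _)
      (Continuous.intervalIntegrable (by fun_prop) _ _), intervalIntegral.integral_const_mul]
  rw [e, sub_pos]
  calc ε' * I ≤ F / (I + 1) * I := mul_le_mul_of_nonneg_right hε' hI
    _ < F / (I + 1) * (I + 1) := by gcongr; linarith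
    _ = F := by field_simp

theorem exists_ge_of_sum_mul_nonneg {L : ℕ} {F w : ℕ → ℝ} {ε : ℝ} (hw : ∀ j ≤ L, 0 < w j)
    (h : 0 ≤ ∑ j ∈ Finset.range (L + 1), (F j - ε) * w j) : ∃ j ≤ L, ε ≤ F j := by
  by_contra! hc
  refine absurd h (not_le.2 (Finset.sum_neg (fun j hj => ?_) ⟨0, by simp⟩))
  have hj' : j ≤ L := Nat.le_of_lt_succ (Finset.mem_range.1 hj)
  exact mul_neg_of_neg_of_pos (by linarith [hc j hj']) (hw j hj')

/-- One-dimensional localization: a weight that is a power of a concave function can be replaced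
by the same power of an affine function on a subinterval. -/
theorem exists_affine_pow_weight_of_concave (n : ℕ) {f g φ : ℝ → ℝ} (hf : Continuous f)
    (hg : Continuous g) (hφc : Continuous φ) (hφ : ∀ s ∈ Icc (0 : ℝ) 1, 0 < φ s)
    (hconc : ConcaveOn ℝ (Icc 0 1) φ) (hfpos : 0 < ∫ s in (0 : ℝ)..1, f s * φ s ^ (n + 1))
    (hgpos : 0 < ∫ s in (0 : ℝ)..1, g s * φ s ^ (n + 1)) :
    ∃ α β c d : ℝ, 0 ≤ α ∧ α ≤ β ∧ β ≤ 1 ∧ (∀ s ∈ Icc (0 : ℝ) 1, 0 < c + d * s) ∧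
      0 < (∫ s in (0 : ℝ)..1, f (α + (β - α) * s) * (c + d * s) ^ (n + 1)) ∧
      0 < ∫ s in (0 : ℝ)..1, g (α + (β - α) * s) * (c + d * s) ^ (n + 1) := by
  have hw0 : ∀ s ∈ Icc (0 : ℝ) 1, 0 ≤ φ s ^ (n + 1) := fun s hs => (pow_pos (hφ s hs) _).le
  obtain ⟨ε₁, hε₁, hf₁⟩ := exists_slack_of_integral_mul_pos hf (hφc.pow _) hw0 hfpos
  obtain ⟨ε₂, hε₂, hg₁⟩ := exists_slack_of_integral_mul_pos hg (hφc.pow _) hw0 hgpos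
  obtain ⟨ε, hε, hfε, hgε⟩ : ∃ ε > 0, (0 < ∫ s in (0 : ℝ)..1, (f s - ε) * φ s ^ (n + 1)) ∧
      0 < ∫ s in (0 : ℝ)..1, (g s - ε) * φ s ^ (n + 1) :=
    ⟨min ε₁ ε₂, lt_min hε₁ hε₂, hf₁ _ (min_le_left _ _), hg₁ _ (min_le_right _ _)⟩
  set N : ℕ := n + 1 with hN
  set ε' : ℝ := ε / (4 * (N + 1)) with hε'
  have hε'pos : 0 < ε' := by positivity
  have hε'lt : ε' < ε := by
    rw [hε', div_lt_iff₀ (by positivity)]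
    have : (0 : ℝ) ≤ N := Nat.cast_nonneg _
    nlinarith
  obtain ⟨δ₁, hδ₁, hfδ⟩ := hf.exists_modulus_Icc hε'pos
  obtain ⟨δ₂, hδ₂, hgδ⟩ := hg.exists_modulus_Icc hε'pos
  obtain ⟨B₁, hB₁⟩ :=
    isCompact_Icc.exists_bound_of_continuousOn (hf.continuousOn (s := Icc (0 : ℝ) 1))
  obtain ⟨B₂, hB₂⟩ :=
    isCompact_Icc.exists_bound_of_continuousOn (hg.continuousOn (s := Icc (0 : ℝ) 1))
  set B := max B₁ B₂
  set δ := min δ₁ δ₂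
  have hδ : 0 < δ := lt_min hδ₁ hδ₂
  have hB0 : 0 ≤ B := (norm_nonneg _).trans ((hB₁ 0 ⟨le_rfl, zero_le_one⟩).trans (le_max_left _ _))
  obtain ⟨L₀, hL₀⟩ := exists_nat_gt (max 1 ((B + ε) * (N + 1) / ε'))
  have hL₀1 : (1 : ℝ) < L₀ := (le_max_left _ _).trans_lt hL₀
  have hL₀2 : (B + ε) * (N + 1) / ε' < L₀ := (le_max_right _ _).trans_lt hL₀
  have hR₁ := eventually_riemannSum_pos (by fun_prop) hfε
  have hR₂ := eventually_riemannSum_pos (by fun_prop) hgε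
  obtain ⟨M, hM1, hM2, hMδ, hM0⟩ := (hR₁.and (hR₂.and
    (((tendsto_const_div_atTop_nhds_zero_nat (L₀ : ℝ)).eventually (gt_mem_nhds hδ)).and
      (Filter.eventually_gt_atTop 0)))).exists
  have hM' : (0 : ℝ) < M := by exact_mod_cast hM0
  obtain ⟨c, d, i, L, hiL, hpos, hfs, hgs⟩ := exists_affine_pow_weight_grid n hM0
    (f := fun s => f s - ε) (g := fun s => g s - ε) hφ hconc hM1 hM2
  have hgrid : ∀ j ≤ L, ((i + j : ℕ) : ℝ) / M ∈ Icc (0 : ℝ) 1 := fun j hj =>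
    ⟨by positivity, (div_le_one hM').2 (by exact_mod_cast (by omega : i + j ≤ M))⟩
  rcases Nat.lt_or_ge L L₀ with hL | hL
  · have key : ∀ h : ℝ → ℝ, (∀ x ∈ Icc (0 : ℝ) 1, ∀ y ∈ Icc (0 : ℝ) 1, |x - y| ≤ δ →
        |h x - h y| ≤ ε') → 0 ≤ ∑ j ∈ Finset.range (L + 1), (h (((i + j : ℕ) : ℝ) / M) - ε) *
        (c + d * (((i + j : ℕ) : ℝ) / M)) ^ (n + 1) → 0 < h (((i + 0 : ℕ) : ℝ) / M) := by
      intro h hh hs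
      obtain ⟨j, hj, hjε⟩ := exists_ge_of_sum_mul_nonneg (F := fun j => h (((i + j : ℕ) : ℝ) / M))
        (fun j hj => pow_pos (hpos j hj) (n + 1)) hs
      have := (abs_le.1 (hh _ (hgrid j hj) _ (hgrid 0 (Nat.zero_le _)) ?_)).2
      · linarith
      · have hj' : (j : ℝ) ≤ L₀ := by exact_mod_cast (hj.trans hL.le)
        rw [← sub_div, abs_div, abs_of_pos hM']
        push_cast
        rw [add_zero, add_sub_cancel_left, abs_of_nonneg (Nat.cast_nonneg _)]
        exact (div_le_div_of_nonneg_right hj' hM'.le).trans hMδ.le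
    have h0 := hgrid 0 (Nat.zero_le _)
    refine ⟨_, _, 1, 0, h0.1, le_rfl, h0.2, by simp, ?_, ?_⟩
    · simpa using key f (fun x hx y hy hxy => hfδ x hx y hy (hxy.trans (min_le_left _ _))) hfs
    · simpa using key g (fun x hx y hy hxy => hgδ x hx y hy (hxy.trans (min_le_right _ _))) hgs
  · have hL0 : (0 : ℝ) < L := lt_of_lt_of_le (by linarith) (Nat.cast_le.2 hL)
    set α : ℝ := ((i + 0 : ℕ) : ℝ) / M with hα
    set β : ℝ := ((i + L : ℕ) : ℝ) / M with hβ
    have hα' := hgrid 0 (Nat.zero_le _)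
    have hβ' := hgrid L le_rfl
    have hαβ : α ≤ β := div_le_div_of_nonneg_right (by push_cast; linarith) hM'.le
    have hdist : (β - α) / L = 1 / M := by
      rw [hα, hβ]; push_cast; field_simp; ring
    have hpt : ∀ j : ℕ, ((i + j : ℕ) : ℝ) / M = α + (β - α) * (j / L) := fun j => by
      rw [mul_div_left_comm, hdist, hα]; push_cast; ring
    set p₀ := c + d * α with hp₀
    set q₀ := c + d * β with hq₀
    have hp : 0 < p₀ := hpos 0 (Nat.zero_le _)
    have hq : 0 < q₀ := hpos L le_rfl
    set k := max p₀ q₀ with hk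
    have hk0 : 0 < k := lt_max_of_lt_left hp
    have hwt : ∀ j : ℕ, p₀ / k + (q₀ / k - p₀ / k) * (j / L) =
        (c + d * (((i + j : ℕ) : ℝ) / M)) / k := fun j => by
      rw [hpt, hp₀, hq₀]; ring
    have key : ∀ h : ℝ → ℝ, Continuous h → (∀ x ∈ Icc (0 : ℝ) 1, |h x| ≤ B) →
        (∀ x ∈ Icc (0 : ℝ) 1, ∀ y ∈ Icc (0 : ℝ) 1, |x - y| ≤ δ → |h x - h y| ≤ ε') →
        0 ≤ ∑ j ∈ Finset.range (L + 1), (h (((i + j : ℕ) : ℝ) / M) - ε) *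
        (c + d * (((i + j : ℕ) : ℝ) / M)) ^ (n + 1) →
        0 < ∫ s in (0 : ℝ)..1, h (α + (β - α) * s) * (p₀ / k + (q₀ / k - p₀ / k) * s) ^ N := by
      intro h hc hb hh hs
      have hsub : Icc α β ⊆ Icc 0 1 := Icc_subset_Icc hα'.1 hβ'.2
      refine integral_affine_pow_pos_of_sum_nonneg N hc hαβ (by exact_mod_cast hL0)
        (div_pos hp hk0) (div_pos hq hk0) ((div_le_one hk0).2 (le_max_left _ _))
        ((div_le_one hk0).2 (le_max_right _ _)) ?_ hε (fun x hx => hb x (hsub hx))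
        (ε' := ε') (fun x hx y hy hxy => hh x (hsub hx) y (hsub hy) (hxy.trans ?_)) ?_ ?_
      · rcases max_choice p₀ q₀ with h | h
        · left; rw [hk, h, div_self hp.ne']
        · right; rw [hk, h, div_self hq.ne']
      · rw [hdist]
        exact (div_le_div_of_nonneg_right hL₀1.le hM'.le).trans hMδ.le
      · simp only [hwt, ← hpt]
        rw [Finset.sum_congr rfl fun j _ => by rw [div_pow, ← mul_div_assoc], ← Finset.sum_div]
        exact div_nonneg hs (pow_nonneg hk0.le _)
      · have h1 : (B + ε) * (N + 1) / L ≤ ε' := by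
          rw [div_le_iff₀ hL0]
          rw [div_lt_iff₀ hε'pos] at hL₀2
          have : (L₀ : ℝ) ≤ L := Nat.cast_le.2 hL
          nlinarith
        have h2 : ε / (N + 1) = 4 * ε' := by rw [hε']; field_simp
        linarith
    refine ⟨α, β, p₀ / k, q₀ / k - p₀ / k, hα'.1, hαβ, hβ'.2, fun s hs => ?_, ?_, ?_⟩
    · have h1 : 0 < p₀ / k := div_pos hp hk0
      have h2 : 0 < q₀ / k := div_pos hq hk0
      rcases hs.1.eq_or_lt with rfl | hs0
      · simpa using h1
      · nlinarith [hs.2, mul_pos h2 hs0]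
    · exact key f hf (fun x hx => (hB₁ x hx).trans (le_max_left _ _))
        (fun x hx y hy hxy => hfδ x hx y hy (hxy.trans (min_le_left _ _))) hfs
    · exact key g hg (fun x hx => (hB₂ x hx).trans (le_max_right _ _))
        (fun x hx y hy hxy => hgδ x hx y hy (hxy.trans (min_le_right _ _))) hgs

/-- The open half-plane through `P` with inner normal `(cos θ, sin θ)`. -/
def halfPlane (P : ℝ × ℝ) (θ : ℝ) : Set (ℝ × ℝ) :=
  {z | 0 < Real.cos θ * (z.1 - P.1) + Real.sin θ * (z.2 - P.2)}

theorem isOpen_halfPlane (P : ℝ × ℝ) (θ : ℝ) : IsOpen (halfPlane P θ) :=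
  isOpen_lt continuous_const (by fun_prop)

theorem convex_halfPlane (P : ℝ × ℝ) (θ : ℝ) : Convex ℝ (halfPlane P θ) := by
  intro x hx y hy s t hs ht hst
  simp only [halfPlane, mem_ofPred_eq, Prod.fst_add, Prod.snd_add, Prod.smul_fst, Prod.smul_snd,
    smul_eq_mul] at *
  have e : Real.cos θ * (s * x.1 + t * y.1 - P.1) + Real.sin θ * (s * x.2 + t * y.2 - P.2) =
      s * (Real.cos θ * (x.1 - P.1) + Real.sin θ * (x.2 - P.2)) +
      t * (Real.cos θ * (y.1 - P.1) + Real.sin θ * (y.2 - P.2)) := by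
    linear_combination (Real.cos θ * P.1 + Real.sin θ * P.2) * hst
  rw [e]
  rcases hs.eq_or_lt with rfl | hs
  · rw [show t = 1 by linarith]; simpa using hy
  · have := mul_pos hs hx
    have := mul_nonneg ht hy.le
    linarith

theorem ae_not_mem_line (P : ℝ × ℝ) (θ : ℝ) :
    ∀ᵐ z : ℝ × ℝ, Real.cos θ * (z.1 - P.1) + Real.sin θ * (z.2 - P.2) ≠ 0 := by
  let φ : ℝ × ℝ →ₗ[ℝ] ℝ := Real.cos θ • LinearMap.fst ℝ ℝ ℝ + Real.sin θ • LinearMap.snd ℝ ℝ ℝ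
  have hφ : LinearMap.ker φ ≠ ⊤ := by
    rw [Ne, LinearMap.ker_eq_top]
    intro h
    have := congrArg (fun ψ : ℝ × ℝ →ₗ[ℝ] ℝ => ψ (Real.cos θ, Real.sin θ)) h
    simp [φ] at this
    nlinarith [Real.cos_sq_add_sin_sq θ]
  have h0 : volume (LinearMap.ker φ : Set (ℝ × ℝ)) = 0 := Measure.addHaar_submodule _ _ hφ
  have h1 := (measurePreserving_sub_right (volume : Measure (ℝ × ℝ)) P).quasiMeasurePreserving.ae
    (measure_eq_zero_iff_ae_notMem.1 h0)
  filter_upwards [h1] with z hz hz'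
  exact hz (by simpa [φ] using hz')

theorem continuous_setIntegral_halfPlane {K : Set (ℝ × ℝ)} {f : ℝ × ℝ → ℝ}
    (hf : IntegrableOn f K) (P : ℝ × ℝ) :
    Continuous fun θ => ∫ z in K, (halfPlane P θ).indicator f z := by
  refine continuous_iff_continuousAt.2 fun θ₀ => ?_
  refine continuousAt_of_dominated (bound := fun z => ‖f z‖) (.of_forall fun θ => ?_)
    (.of_forall fun θ => .of_forall fun z => norm_indicator_le_norm_self _ _) hf.norm ?_
  · exact hf.aestronglyMeasurable.indicator (isOpen_halfPlane P θ).measurableSet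
  · filter_upwards [ae_restrict_of_ae (ae_not_mem_line P θ₀)] with z hz
    have hc : Continuous fun θ => Real.cos θ * (z.1 - P.1) + Real.sin θ * (z.2 - P.2) := by
      fun_prop
    rcases hz.lt_or_gt with h | h
    · refine (continuousAt_const (y := (0 : ℝ))).congr ?_
      filter_upwards [hc.continuousAt.eventually_lt continuousAt_const h] with θ hθ
      exact (indicator_of_notMem (show z ∉ halfPlane P θ from not_lt.2 hθ.le) f).symm
    · refine (continuousAt_const (y := f z)).congr ?_
      filter_upwards [continuousAt_const.eventually_lt hc.continuousAt h] with θ hθ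
      exact (indicator_of_mem (show z ∈ halfPlane P θ from hθ) f).symm

theorem setIntegral_halfPlane_add {K : Set (ℝ × ℝ)} {f : ℝ × ℝ → ℝ}
    (hf : IntegrableOn f K) (P : ℝ × ℝ) (θ : ℝ) :
    (∫ z in K, (halfPlane P θ).indicator f z) +
      ∫ z in K, (halfPlane P (θ + Real.pi)).indicator f z = ∫ z in K, f z := by
  rw [← integral_add (hf.indicator (isOpen_halfPlane P _).measurableSet)
    (hf.indicator (isOpen_halfPlane P _).measurableSet)]
  refine integral_congr_ae ?_
  filter_upwards [ae_restrict_of_ae (ae_not_mem_line P θ)] with z hz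
  have e : z ∈ halfPlane P (θ + Real.pi) ↔
      Real.cos θ * (z.1 - P.1) + Real.sin θ * (z.2 - P.2) < 0 := by
    simp only [halfPlane, mem_ofPred_eq, Real.cos_add_pi, Real.sin_add_pi]
    constructor <;> intro h <;> linarith
  rcases hz.lt_or_gt with h | h
  · rw [indicator_of_notMem (show z ∉ halfPlane P θ from not_lt.2 h.le),
      indicator_of_mem (e.2 h), zero_add]
  · rw [indicator_of_mem (show z ∈ halfPlane P θ from h),
      indicator_of_notMem (fun h' => absurd (e.1 h') (not_lt.2 h.le)), add_zero]

theorem exists_convex_avoiding_point {K : Set (ℝ × ℝ)} (hKo : IsOpen K) (hKc : Convex ℝ K)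
    {f g : ℝ × ℝ → ℝ} (hf : IntegrableOn f K) (hg : IntegrableOn g K)
    (hfpos : 0 < ∫ z in K, f z) (hgpos : 0 < ∫ z in K, g z) (P : ℝ × ℝ) :
    ∃ K' ⊆ K, IsOpen K' ∧ Convex ℝ K' ∧ P ∉ K' ∧ 0 < (∫ z in K', f z) ∧ 0 < ∫ z in K', g z := by
  set a : ℝ → ℝ := fun θ => ∫ z in K, (halfPlane P θ).indicator f z with ha
  have hac : Continuous a := continuous_setIntegral_halfPlane hf P
  have hadd : ∀ θ, a θ + a (θ + Real.pi) = ∫ z in K, f z := setIntegral_halfPlane_add hf P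
  have hmid : (∫ z in K, f z) / 2 ∈ range a := by
    have h0 := hadd 0
    rcases le_total (a 0) (a (0 + Real.pi)) with h | h
    · exact mem_range_of_exists_le_of_exists_ge hac ⟨0, by linarith⟩ ⟨0 + Real.pi, by linarith⟩
    · exact mem_range_of_exists_le_of_exists_ge hac ⟨0 + Real.pi, by linarith⟩ ⟨0, by linarith⟩
  obtain ⟨θ, hθ⟩ := hmid
  have hgadd := setIntegral_halfPlane_add hg P θ
  have hθ' := hadd θ
  have key : ∀ τ, 0 < a τ → 0 < (∫ z in K, (halfPlane P τ).indicator g z) →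
      ∃ K' ⊆ K, IsOpen K' ∧ Convex ℝ K' ∧ P ∉ K' ∧ 0 < (∫ z in K', f z) ∧
        0 < ∫ z in K', g z := by
    intro τ h1 h2
    have hm := (isOpen_halfPlane P τ).measurableSet
    simp only [ha] at h1
    rw [setIntegral_indicator hm] at h1 h2
    refine ⟨K ∩ halfPlane P τ, inter_subset_left, hKo.inter (isOpen_halfPlane P τ),
      hKc.inter (convex_halfPlane P τ), fun h => ?_, h1, h2⟩
    simpa [halfPlane] using h.2
  rcases lt_or_ge 0 (∫ z in K, (halfPlane P θ).indicator g z) with h | h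
  · exact key θ (by linarith) h
  · exact key (θ + Real.pi) (by linarith) (by linarith)

theorem exists_convex_avoiding_finset {K : Set (ℝ × ℝ)} (hKo : IsOpen K) (hKc : Convex ℝ K)
    {f g : ℝ × ℝ → ℝ} (hf : IntegrableOn f K) (hg : IntegrableOn g K)
    (hfpos : 0 < ∫ z in K, f z) (hgpos : 0 < ∫ z in K, g z) (T : Finset (ℝ × ℝ)) :
    ∃ K' ⊆ K, IsOpen K' ∧ Convex ℝ K' ∧ (∀ P ∈ T, P ∉ K') ∧ 0 < (∫ z in K', f z) ∧
      0 < ∫ z in K', g z := by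
  induction T using Finset.cons_induction with
  | empty => exact ⟨K, Subset.rfl, hKo, hKc, by simp, hfpos, hgpos⟩
  | cons P T _ ih =>
    obtain ⟨K₁, h₁, ho₁, hc₁, hT₁, hf₁, hg₁⟩ := ih
    obtain ⟨K₂, h₂, ho₂, hc₂, hP₂, hf₂, hg₂⟩ := exists_convex_avoiding_point ho₁ hc₁
      (hf.mono_set h₁) (hg.mono_set h₁) hf₁ hg₁ P
    refine ⟨K₂, h₂.trans h₁, ho₂, hc₂, fun Q hQ => ?_, hf₂, hg₂⟩
    rcases Finset.mem_cons.1 hQ with rfl | hQ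
    · exact hP₂
    · exact fun h => hT₁ Q hQ (h₂ h)

theorem eq_Ioo_of_isOpen_of_convex {A : Set ℝ} (ho : IsOpen A) (hc : Convex ℝ A)
    (hne : A.Nonempty) (hb : Bornology.IsBounded A) : A = Ioo (sInf A) (sSup A) := by
  refine Subset.antisymm ?_ ((hc.isConnected hne).Ioo_csInf_csSup_subset hb.bddBelow hb.bddAbove)
  rw [← interior_Icc]
  exact interior_maximal (subset_Icc_csInf_csSup hb.bddBelow hb.bddAbove) ho

/-- The length of the vertical section of a convex planar set over `t`. -/
noncomputable def sectionLength (K : Set (ℝ × ℝ)) (t : ℝ) : ℝ :=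
  sSup (Prod.mk t ⁻¹' K) - sInf (Prod.mk t ⁻¹' K)

theorem section_eq_Ioo {K : Set (ℝ × ℝ)} (hKo : IsOpen K) (hKc : Convex ℝ K)
    (hKb : Bornology.IsBounded K) {t : ℝ} (ht : (Prod.mk t ⁻¹' K).Nonempty) :
    Prod.mk t ⁻¹' K = Ioo (sInf (Prod.mk t ⁻¹' K)) (sSup (Prod.mk t ⁻¹' K)) := by
  refine eq_Ioo_of_isOpen_of_convex (hKo.preimage (by fun_prop)) ?_ ht ?_
  · intro y hy z hz s r hs hr hsr
    have := hKc hy hz hs hr hsr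
    simp only [mem_preimage] at *
    convert this using 1
    ext
    · simp only [Prod.fst_add, Prod.smul_fst, smul_eq_mul]
      linear_combination (-t) * hsr
    · simp
  · exact hKb.image_snd.subset fun y hy => ⟨_, hy, rfl⟩

theorem sectionLength_pos {K : Set (ℝ × ℝ)} (hKo : IsOpen K) (hKc : Convex ℝ K)
    (hKb : Bornology.IsBounded K) {t : ℝ} (ht : t ∈ Prod.fst '' K) : 0 < sectionLength K t := by
  have hne : (Prod.mk t ⁻¹' K).Nonempty := by simpa [Set.Nonempty] using ht
  rw [section_eq_Ioo hKo hKc hKb hne, nonempty_Ioo] at hne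
  exact sub_pos.2 hne

theorem concaveOn_sectionLength {K : Set (ℝ × ℝ)} (hKc : Convex ℝ K)
    (hKb : Bornology.IsBounded K) : ConcaveOn ℝ (Prod.fst '' K) (sectionLength K) := by
  refine ⟨hKc.linear_image (LinearMap.fst ℝ ℝ ℝ), ?_⟩
  have hbdd : ∀ t, Bornology.IsBounded (Prod.mk t ⁻¹' K) := fun t =>
    hKb.image_snd.subset fun y hy => ⟨_, hy, rfl⟩
  have happrox : ∀ t ∈ Prod.fst '' K, ∀ η > 0, ∃ y z : ℝ, (t, y) ∈ K ∧ (t, z) ∈ K ∧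
      sectionLength K t < z - y + η := by
    rintro _ ⟨⟨t, y⟩, hy, rfl⟩ η hη
    have hne : (Prod.mk t ⁻¹' K).Nonempty := ⟨y, hy⟩
    obtain ⟨z, hz, hz'⟩ := exists_lt_of_lt_csSup hne
      (show sSup (Prod.mk t ⁻¹' K) - η / 2 < _ by linarith)
    obtain ⟨w, hw, hw'⟩ := exists_lt_of_csInf_lt hne
      (show _ < sInf (Prod.mk t ⁻¹' K) + η / 2 by linarith)
    exact ⟨w, z, hw, hz, by unfold sectionLength; linarith⟩
  intro t₁ ht₁ t₂ ht₂ s r hs hr hsr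
  refine le_of_forall_pos_le_add fun η hη => ?_
  obtain ⟨y₁, z₁, hy₁, hz₁, h₁⟩ := happrox t₁ ht₁ η hη
  obtain ⟨y₂, z₂, hy₂, hz₂, h₂⟩ := happrox t₂ ht₂ η hη
  have hy : s * y₁ + r * y₂ ∈ Prod.mk (s • t₁ + r • t₂) ⁻¹' K := hKc hy₁ hy₂ hs hr hsr
  have hz : s * z₁ + r * z₂ ∈ Prod.mk (s • t₁ + r • t₂) ⁻¹' K := hKc hz₁ hz₂ hs hr hsr
  have hle₁ := csInf_le (hbdd _).bddBelow hy
  have hle₂ := le_csSup (hbdd _).bddAbove hz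
  have e₁ := mul_le_mul_of_nonneg_left h₁.le hs
  have e₂ := mul_le_mul_of_nonneg_left h₂.le hr
  have e₃ : s * η + r * η = η := by rw [← add_mul, hsr, one_mul]
  simp only [smul_eq_mul]
  unfold sectionLength at *
  simp only [smul_eq_mul] at hle₁ hle₂
  linarith

theorem integral_section_le {K : Set (ℝ × ℝ)} (hKo : IsOpen K) (hKc : Convex ℝ K)
    (hKb : Bornology.IsBounded K) {f : ℝ × ℝ → ℝ} (hf : Continuous f) {ε : ℝ}
    (hosc : ∀ t y y', (t, y) ∈ K → (t, y') ∈ K → |f (t, y) - f (t, y')| ≤ ε) {t m : ℝ}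
    (hm : (t, m) ∈ K) :
    ∫ y, K.indicator (fun z => f z - ε) (t, y) ≤ f (t, m) * sectionLength K t := by
  have hne : (Prod.mk t ⁻¹' K).Nonempty := ⟨m, hm⟩
  have hms : MeasurableSet (Prod.mk t ⁻¹' K) := (hKo.preimage (by fun_prop)).measurableSet
  have e : ∫ y, K.indicator (fun z => f z - ε) (t, y) =
      ∫ y in Prod.mk t ⁻¹' K, (f (t, y) - ε) := by
    rw [← integral_indicator hms]; rfl
  have hvol : volume.real (Prod.mk t ⁻¹' K) = sectionLength K t := by
    rw [section_eq_Ioo hKo hKc hKb hne, Real.volume_real_Ioo_of_le, sectionLength]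
    exact (sub_pos.1 (sectionLength_pos hKo hKc hKb ⟨_, hm, rfl⟩)).le
  have hfin : volume (Prod.mk t ⁻¹' K) ≠ ⊤ := by
    rw [section_eq_Ioo hKo hKc hKb hne]; exact measure_Ioo_lt_top.ne
  have hint : IntegrableOn (fun y => f (t, y) - ε) (Prod.mk t ⁻¹' K) := by
    rw [section_eq_Ioo hKo hKc hKb hne]
    exact (Continuous.integrableOn_Icc (by fun_prop)).mono_set Ioo_subset_Icc_self
  calc _ ≤ ∫ _ in Prod.mk t ⁻¹' K, f (t, m) := by
        rw [e]
        refine setIntegral_mono_on hint (integrableOn_const hfin) hms fun y hy => ?_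
        linarith [(abs_le.1 (hosc t y m hy hm)).2]
    _ = _ := by rw [setIntegral_const, hvol, smul_eq_mul, mul_comm]

theorem exists_Icc_subset_integral_pos {F G : ℝ → ℝ} (hF : Integrable F) (hG : Integrable G)
    {A B : ℝ} (hAB : A < B) (hFpos : 0 < ∫ t in A..B, F t) (hGpos : 0 < ∫ t in A..B, G t) :
    ∃ α β, A < α ∧ α < β ∧ β < B ∧ 0 < (∫ t in α..β, F t) ∧ 0 < ∫ t in α..β, G t := by
  have key : ∀ H : ℝ → ℝ, Integrable H → 0 < (∫ t in A..B, H t) →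
      ∀ᶠ η in nhds (0 : ℝ), 0 < ∫ t in (A + η)..(B - η), H t := by
    intro H hH hpos
    have hI : ∀ a b, IntervalIntegrable H volume a b := fun a b => hH.intervalIntegrable
    have hc : Continuous fun η : ℝ => ∫ t in (A + η)..(B - η), H t := by
      have e : (fun η : ℝ => ∫ t in (A + η)..(B - η), H t) =
          fun η => (∫ t in (0 : ℝ)..(B - η), H t) - ∫ t in (0 : ℝ)..(A + η), H t := by
        funext η
        rw [intervalIntegral.integral_interval_sub_left (hI _ _) (hI _ _)]
      rw [e]
      have hp := intervalIntegral.continuous_primitive hI 0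
      exact (hp.comp (by fun_prop : Continuous fun η : ℝ => B - η)).sub
        (hp.comp (by fun_prop : Continuous fun η : ℝ => A + η))
    exact continuousAt_const.eventually_lt hc.continuousAt (by simpa using hpos)
  have h := ((key F hF hFpos).and (key G hG hGpos)).and
    (gt_mem_nhds (show (0 : ℝ) < (B - A) / 2 by linarith))
  obtain ⟨η, ⟨⟨h1, h2⟩, h3⟩, h4⟩ :=
    ((h.filter_mono nhdsWithin_le_nhds).and (self_mem_nhdsWithin (s := Ioi (0 : ℝ)))).exists
  have h4 : 0 < η := h4
  exact ⟨A + η, B - η, by linarith, by linarith, by linarith, h1, h2⟩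

/-- If `f` and `g` vary little along vertical sections of `K`, a chord of `K` weighted with the
section length carries positive integrals. -/
theorem exists_concave_weight_of_section_oscillation {K : Set (ℝ × ℝ)} (hKo : IsOpen K)
    (hKc : Convex ℝ K) (hKb : Bornology.IsBounded K) {f g : ℝ × ℝ → ℝ} (hf : Continuous f)
    (hg : Continuous g) {ε : ℝ}
    (hfo : ∀ t y y', (t, y) ∈ K → (t, y') ∈ K → |f (t, y) - f (t, y')| ≤ ε)
    (hgo : ∀ t y y', (t, y) ∈ K → (t, y') ∈ K → |g (t, y) - g (t, y')| ≤ ε)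
    (hfpos : 0 < ∫ z in K, (f z - ε)) (hgpos : 0 < ∫ z in K, (g z - ε)) :
    ∃ a ∈ K, ∃ b ∈ K, ∃ ψ : ℝ → ℝ, Continuous ψ ∧ (∀ s ∈ Icc (0 : ℝ) 1, 0 < ψ s) ∧
      ConcaveOn ℝ (Icc 0 1) ψ ∧ 0 < (∫ s in (0 : ℝ)..1, f ((1 - s) • a + s • b) * ψ s) ∧
      0 < ∫ s in (0 : ℝ)..1, g ((1 - s) • a + s • b) * ψ s := by
  set J := Prod.fst '' K with hJ
  have hKm := hKo.measurableSet
  have hJo : IsOpen J := isOpenMap_fst K hKo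
  have hJc : Convex ℝ J := hKc.linear_image (LinearMap.fst ℝ ℝ ℝ)
  have hKne : K.Nonempty := by
    rw [nonempty_iff_ne_empty]
    rintro rfl
    simp at hfpos
  have hJI : J = Ioo (sInf J) (sSup J) :=
    eq_Ioo_of_isOpen_of_convex hJo hJc (hKne.image _) hKb.image_fst
  have hAB : sInf J < sSup J := by
    have : J.Nonempty := hKne.image _
    rwa [hJI, nonempty_Ioo] at this
  have hint : ∀ h : ℝ × ℝ → ℝ, Continuous h → Integrable (K.indicator fun z => h z - ε) := by
    intro h hh
    rw [integrable_indicator_iff hKm]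
    exact ((Continuous.continuousOn (by fun_prop)).integrableOn_compact
      hKb.isCompact_closure).mono_set subset_closure
  have hfub : ∀ h : ℝ × ℝ → ℝ, Continuous h → ∫ z in K, (h z - ε) =
      ∫ t in (sInf J)..(sSup J), ∫ y, K.indicator (fun z => h z - ε) (t, y) := by
    intro h hh
    rw [← integral_indicator hKm, Measure.volume_eq_prod, integral_prod _ (hint h hh),
      intervalIntegral.integral_of_le hAB.le, integral_Ioc_eq_integral_Ioo, ← hJI,
      setIntegral_eq_integral_of_forall_compl_eq_zero]
    intro t ht
    have : ∀ y, K.indicator (fun z => h z - ε) (t, y) = 0 := fun y =>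
      indicator_of_notMem (fun hy => ht ⟨_, hy, rfl⟩) _
    simp [this]
  rw [hfub f hf] at hfpos
  rw [hfub g hg] at hgpos
  obtain ⟨α, β, hα, hαβ, hβ, hF, hG⟩ := exists_Icc_subset_integral_pos
    (hint f hf).integral_prod_left (hint g hg).integral_prod_left hAB hfpos hgpos
  have hsub : Icc α β ⊆ J := by
    rw [hJI]; exact fun t ht => ⟨hα.trans_le ht.1, ht.2.trans_lt hβ⟩
  obtain ⟨yα, ha⟩ : ∃ y, (α, y) ∈ K := by simpa [hJ] using hsub ⟨le_rfl, hαβ.le⟩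
  obtain ⟨yβ, hb⟩ : ∃ y, (β, y) ∈ K := by simpa [hJ] using hsub ⟨hαβ.le, le_rfl⟩
  have hβα : 0 < β - α := sub_pos.2 hαβ
  have hclip : ∀ s : ℝ, α + (β - α) * max 0 (min s 1) ∈ Icc α β := fun s =>
    ⟨by nlinarith [le_max_left 0 (min s 1)],
      by nlinarith [max_le zero_le_one (min_le_right s 1)]⟩
  have hclip' : ∀ s ∈ Icc (0 : ℝ) 1, max 0 (min s 1) = s := fun s hs => by
    rw [min_eq_left hs.2, max_eq_right hs.1]
  have hconc := concaveOn_sectionLength hKc hKb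
  set ψ : ℝ → ℝ := fun s => sectionLength K (α + (β - α) * max 0 (min s 1)) with hψ
  have hψc : Continuous ψ := (hconc.continuousOn hJo).comp_continuous (by fun_prop)
    fun s => hsub (hclip s)
  have hpt : ∀ s : ℝ, (1 - s) • ((α, yα) : ℝ × ℝ) + s • ((β, yβ) : ℝ × ℝ) =
      (α + (β - α) * s, (1 - s) * yα + s * yβ) := fun s => by
    ext
    · simp only [Prod.fst_add, Prod.smul_fst, smul_eq_mul]; ring
    · simp
  have key : ∀ h : ℝ × ℝ → ℝ, Continuous h →
      (∀ t y y', (t, y) ∈ K → (t, y') ∈ K → |h (t, y) - h (t, y')| ≤ ε) →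
      0 < (∫ t in α..β, ∫ y, K.indicator (fun z => h z - ε) (t, y)) →
      0 < ∫ s in (0 : ℝ)..1, h ((1 - s) • ((α, yα) : ℝ × ℝ) + s • ((β, yβ) : ℝ × ℝ)) * ψ s := by
    intro h hh hosc hpos
    have e := intervalIntegral.smul_integral_comp_add_mul (a := 0) (b := 1)
      (fun t => ∫ y, K.indicator (fun z => h z - ε) (t, y)) (β - α) α
    rw [mul_zero, add_zero, mul_one, add_sub_cancel, smul_eq_mul] at e
    rw [← e] at hpos
    refine (pos_of_mul_pos_right hpos hβα.le).trans_le ?_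
    refine intervalIntegral.integral_mono_on zero_le_one ?_ ?_ fun s hs => ?_
    · exact (((hint h hh).integral_prod_left.comp_add_left α).comp_mul_left'
        hβα.ne').intervalIntegrable
    · exact Continuous.intervalIntegrable (by fun_prop) _ _
    · have hmem := hKc ha hb (sub_nonneg.2 hs.2) hs.1 (sub_add_cancel 1 s)
      rw [hpt] at hmem ⊢
      simp only [hψ, hclip' s hs]
      exact integral_section_le hKo hKc hKb hh hosc hmem
  refine ⟨_, ha, _, hb, ψ, hψc, fun s _ => sectionLength_pos hKo hKc hKb (hsub (hclip s)), ?_,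
    key f hf hfo hF, key g hg hgo hG⟩
  refine ⟨convex_Icc 0 1, fun s hs t ht p q hp hq hpq => ?_⟩
  have hst := convex_Icc (0 : ℝ) 1 hs ht hp hq hpq
  have := hconc.2 (hsub (hclip s)) (hsub (hclip t)) hp hq hpq
  simp only [hψ, hclip' _ hst]
  convert this using 2
  rw [hclip' s hs, hclip' t ht]
  simp only [smul_eq_mul]
  linear_combination (-α) * hpq

/-- A convex subset of `(0, 1) × (-R, R)` that misses a fine grid is narrow in one of the two
coordinate directions. -/
theorem narrow_of_avoids_grid {R : ℝ} {K : Set (ℝ × ℝ)} (hKc : Convex ℝ K)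
    (hK : K ⊆ Ioo (0 : ℝ) 1 ×ˢ Ioo (-R) R) {p q m : ℕ} (hp : 0 < p) (hq : 0 < q)
    (hm : R * q + 1 ≤ m)
    (hgrid : ∀ i ∈ Finset.range (p + 1), ∀ j ∈ Finset.Icc (-(m : ℤ)) m,
      ((i : ℝ) / p, (j : ℝ) / q) ∉ K) :
    (∀ x ∈ K, ∀ x' ∈ K, x'.1 - x.1 < 4 / p) ∨
      ∀ t y y', (t, y) ∈ K → (t, y') ∈ K → |y - y'| ≤ p / q := by
  have hp' : (0 : ℝ) < p := by exact_mod_cast hp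
  have hq' : (0 : ℝ) < q := by exact_mod_cast hq
  refine or_iff_not_imp_left.2 fun hwide => ?_
  push Not at hwide
  obtain ⟨x, hx, x', hx', hxx⟩ := hwide
  have hxD := hK hx
  have hxD' := hK hx'
  set k := ⌈x.1 * p⌉₊ with hk
  have hk0 : x.1 * p ≤ k := Nat.le_ceil _
  have hk1 : (k : ℝ) < x.1 * p + 1 := Nat.ceil_lt_add_one (mul_nonneg hxD.1.1.le hp'.le)
  have hxx' : x.1 * p + 4 ≤ x'.1 * p := by
    rw [div_le_iff₀ hp'] at hxx; linarith
  have hb1 : (k : ℝ) + 2 ≤ x'.1 * p := by linarith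
  have hkp : k + 2 ≤ p := by
    have : (k : ℝ) + 2 ≤ p := hb1.trans (mul_le_of_le_one_left hp'.le hxD'.1.2.le)
    exact_mod_cast this
  have hcol : ∀ c : ℝ, x.1 ≤ c → c ≤ x'.1 → ∃ w, (c, w) ∈ K := by
    intro c h1 h2
    have hconv : Convex ℝ (Prod.fst '' K) := hKc.linear_image (LinearMap.fst ℝ ℝ ℝ)
    have := hconv.ordConnected.out ⟨x, hx, rfl⟩ ⟨x', hx', rfl⟩ ⟨h1, h2⟩
    simpa using this
  set b : ℝ := ((k + 1 : ℕ) : ℝ) / p with hb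
  have hbl : b - 1 / p = k / p := by rw [hb]; push_cast; ring
  have hbr : b + 1 / p = (k + 2) / p := by rw [hb]; push_cast; ring
  obtain ⟨wl, hwl⟩ := hcol (b - 1 / p) (by rw [hbl, le_div_iff₀ hp']; exact hk0)
    (by rw [hbl, div_le_iff₀ hp']; linarith)
  obtain ⟨wr, hwr⟩ := hcol (b + 1 / p) (by rw [hbr, le_div_iff₀ hp']; linarith)
    (by rw [hbr, div_le_iff₀ hp']; linarith)
  have hcolb' : ∀ y y', (b, y) ∈ K → (b, y') ∈ K → y' - y ≤ 1 / q := by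
    intro y y' hy hy'
    by_contra! hlt
    have hyD := hK hy
    have hq1 : y * q + 1 < y' * q := by
      rw [div_lt_iff₀ hq'] at hlt; linarith
    have hj0 : y * q ≤ (⌈y * q⌉ : ℤ) := Int.le_ceil _
    have hj1 : ((⌈y * q⌉ : ℤ) : ℝ) < y * q + 1 := Int.ceil_lt_add_one _
    have hyq : y * q < R * q := mul_lt_mul_of_pos_right hyD.2.2 hq'
    have hyq' : -R * q < y * q := mul_lt_mul_of_pos_right hyD.2.1 hq'
    refine hgrid (k + 1) (by simp; omega) ⌈y * q⌉ ?_ ?_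
    · rw [Finset.mem_Icc]
      constructor
      · have : (-(m : ℝ)) ≤ (⌈y * q⌉ : ℤ) := by linarith
        exact_mod_cast this
      · have : ((⌈y * q⌉ : ℤ) : ℝ) ≤ m := by linarith
        exact_mod_cast this
    · have hyy : y < y' := by
        have : (0 : ℝ) < 1 / q := by positivity
        linarith
      have hcv : Convex ℝ (Prod.mk b ⁻¹' K) := by
        intro u hu w hw s r hs hr hsr
        have := hKc hu hw hs hr hsr
        simp only [mem_preimage] at *
        convert this using 1
        ext
        · simp only [Prod.fst_add, Prod.smul_fst, smul_eq_mul]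
          linear_combination (-b) * hsr
        · simp
      refine hcv.ordConnected.out hy hy' ⟨?_, ?_⟩
      · rw [le_div_iff₀ hq']; exact hj0
      · rw [div_le_iff₀ hq']; linarith
  have hcolb : ∀ y y', (b, y) ∈ K → (b, y') ∈ K → |y - y'| ≤ 1 / q := fun y y' hy hy' =>
    abs_le.2 ⟨by linarith [hcolb' y y' hy hy'], hcolb' y' y hy' hy⟩
  have hscale : ∀ t c w y y' μ : ℝ, (c, w) ∈ K → (t, y) ∈ K → (t, y') ∈ K → 1 / p ≤ μ → μ ≤ 1 →
      μ * t + (1 - μ) * c = b → |y - y'| ≤ p / q := by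
    intro t c w y y' μ hw hy hy' hμ hμ1 hμb
    have hμ0 : 0 ≤ μ := le_trans (by positivity) hμ
    have h1 := hKc hy hw hμ0 (sub_nonneg.2 hμ1) (add_sub_cancel μ 1)
    have h2 := hKc hy' hw hμ0 (sub_nonneg.2 hμ1) (add_sub_cancel μ 1)
    simp only [Prod.smul_mk, smul_eq_mul, Prod.mk_add_mk, hμb] at h1 h2
    have h3 := hcolb _ _ h1 h2
    rw [show μ * y + (1 - μ) * w - (μ * y' + (1 - μ) * w) = μ * (y - y') by ring, abs_mul,
      abs_of_nonneg hμ0] at h3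
    have h4 := (mul_le_mul_of_nonneg_right hμ (abs_nonneg (y - y'))).trans h3
    rw [one_div_mul_eq_div, div_le_iff₀ hp'] at h4
    calc _ ≤ _ := h4
      _ = _ := by ring
  intro t y y' hy hy'
  have htD := (hK hy).1
  have hlD := (hK hwl).1
  have hrD := (hK hwr).1
  have hh : (0 : ℝ) < 1 / p := by positivity
  simp only [mem_Ioo] at htD hlD hrD
  rcases le_total t b with htb | htb
  · have hpos : 0 < b + 1 / p - t := by linarith
    refine hscale t _ wr y y' (1 / p / (b + 1 / p - t)) hwr hy hy' ?_ ?_ ?_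
    · rw [le_div_iff₀ hpos]
      exact mul_le_of_le_one_right hh.le (by linarith)
    · rw [div_le_one hpos]; linarith
    · have := div_mul_cancel₀ (1 / (p : ℝ)) hpos.ne'
      linear_combination -this
  · have hpos : 0 < t - (b - 1 / p) := by linarith
    refine hscale t _ wl y y' (1 / p / (t - (b - 1 / p))) hwl hy hy' ?_ ?_ ?_
    · rw [le_div_iff₀ hpos]
      exact mul_le_of_le_one_right hh.le (by linarith)
    · rw [div_le_one hpos]; linarith
    · have := div_mul_cancel₀ (1 / (p : ℝ)) hpos.ne'
      linear_combination this

theorem exists_slack_of_setIntegral_pos {α : Type*} [MeasurableSpace α] {μ : Measure α} {s : Set α}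
    (hs : μ s ≠ ⊤) {f : α → ℝ} (hf : IntegrableOn f s μ) (hpos : 0 < ∫ x in s, f x ∂μ) :
    ∃ ε > 0, ∀ ε' ≤ ε, 0 < ∫ x in s, (f x - ε') ∂μ := by
  set F := ∫ x in s, f x ∂μ
  have hI : 0 ≤ μ.real s := measureReal_nonneg
  refine ⟨F / (μ.real s + 1), by positivity, fun ε' hε' => ?_⟩
  rw [integral_sub hf (integrableOn_const hs), setIntegral_const, smul_eq_mul, sub_pos, mul_comm]
  calc ε' * μ.real s ≤ F / (μ.real s + 1) * μ.real s := mul_le_mul_of_nonneg_right hε' hI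
    _ < F / (μ.real s + 1) * (μ.real s + 1) := by gcongr; linarith
    _ = F := by field_simp

/-- Planar localization to a segment carrying a concave weight. -/
theorem exists_segment_concave_weight {R : ℝ} {f g : ℝ × ℝ → ℝ} (hf : Continuous f)
    (hg : Continuous g) (hfpos : 0 < ∫ z in Ioo (0 : ℝ) 1 ×ˢ Ioo (-R) R, f z)
    (hgpos : 0 < ∫ z in Ioo (0 : ℝ) 1 ×ˢ Ioo (-R) R, g z) :
    ∃ a ∈ Ioo (0 : ℝ) 1 ×ˢ Ioo (-R) R, ∃ b ∈ Ioo (0 : ℝ) 1 ×ˢ Ioo (-R) R, ∃ ψ : ℝ → ℝ,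
      Continuous ψ ∧ (∀ s ∈ Icc (0 : ℝ) 1, 0 < ψ s) ∧ ConcaveOn ℝ (Icc 0 1) ψ ∧
      0 < (∫ s in (0 : ℝ)..1, f ((1 - s) • a + s • b) * ψ s) ∧
      0 < ∫ s in (0 : ℝ)..1, g ((1 - s) • a + s • b) * ψ s := by
  set D : Set (ℝ × ℝ) := Ioo (0 : ℝ) 1 ×ˢ Ioo (-R) R with hD
  set C : Set (ℝ × ℝ) := Icc (0 : ℝ) 1 ×ˢ Icc (-R) R with hC
  have hCc : IsCompact C := isCompact_Icc.prod isCompact_Icc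
  have hDC : D ⊆ C := prod_mono Ioo_subset_Icc_self Ioo_subset_Icc_self
  have hDb : Bornology.IsBounded D := hCc.isBounded.subset hDC
  have hDo : IsOpen D := isOpen_Ioo.prod isOpen_Ioo
  have hDcv : Convex ℝ D := (convex_Ioo _ _).prod (convex_Ioo _ _)
  have hint : ∀ h : ℝ × ℝ → ℝ, Continuous h → IntegrableOn h D := fun h hh =>
    (hh.continuousOn.integrableOn_compact hCc).mono_set hDC
  have hvol : volume D ≠ ⊤ := hDb.measure_lt_top.ne
  obtain ⟨ε₁, hε₁, hf₁⟩ := exists_slack_of_setIntegral_pos hvol (hint f hf) hfpos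
  obtain ⟨ε₂, hε₂, hg₁⟩ := exists_slack_of_setIntegral_pos hvol (hint g hg) hgpos
  set ε := min ε₁ ε₂
  have hε : 0 < ε := lt_min hε₁ hε₂
  have hmod : ∀ h : ℝ × ℝ → ℝ, Continuous h → ∃ δ > 0, ∀ x ∈ D, ∀ y ∈ D, dist x y ≤ δ →
      |h x - h y| ≤ ε := by
    intro h hh
    obtain ⟨δ, hδ, h'⟩ := Metric.uniformContinuousOn_iff_le.1
      (hCc.uniformContinuousOn_of_continuous hh.continuousOn) ε hε
    exact ⟨δ, hδ, fun x hx y hy hxy => h' x (hDC hx) y (hDC hy) hxy⟩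
  obtain ⟨δ₁, hδ₁, hfδ⟩ := hmod f hf
  obtain ⟨δ₂, hδ₂, hgδ⟩ := hmod g hg
  set δ := min δ₁ δ₂
  have hδ : 0 < δ := lt_min hδ₁ hδ₂
  obtain ⟨p, hp⟩ := exists_nat_gt (4 / δ)
  have hp0 : (0 : ℝ) < p := lt_trans (by positivity) hp
  obtain ⟨q, hq⟩ := exists_nat_gt (p / δ)
  have hq0 : (0 : ℝ) < q := lt_trans (by positivity) hq
  obtain ⟨m, hm⟩ := exists_nat_ge (R * q + 1)
  have hpδ : 4 / (p : ℝ) ≤ δ := by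
    rw [div_lt_iff₀ hδ] at hp
    rw [div_le_iff₀ hp0]; linarith
  have hqδ : (p : ℝ) / q ≤ δ := by
    rw [div_lt_iff₀ hδ] at hq
    rw [div_le_iff₀ hq0]; linarith
  obtain ⟨K, hKD, hKo, hKc, hKT, hfK, hgK⟩ := exists_convex_avoiding_finset hDo hDcv
    (hint (fun z => f z - ε) (by fun_prop)) (hint (fun z => g z - ε) (by fun_prop))
    (hf₁ ε (min_le_left _ _)) (hg₁ ε (min_le_right _ _))
    ((Finset.range (p + 1) ×ˢ Finset.Icc (-(m : ℤ)) m).image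
      fun ij => ((ij.1 : ℝ) / p, (ij.2 : ℝ) / q))
  have hKb := hDb.subset hKD
  have hosc : ∀ x ∈ K, ∀ y ∈ K, dist x y ≤ δ → |f x - f y| ≤ ε ∧ |g x - g y| ≤ ε :=
    fun x hx y hy hxy => ⟨hfδ x (hKD hx) y (hKD hy) (hxy.trans (min_le_left _ _)),
      hgδ x (hKD hx) y (hKD hy) (hxy.trans (min_le_right _ _))⟩
  rcases narrow_of_avoids_grid hKc hKD (by exact_mod_cast hp0) (by exact_mod_cast hq0) hm
    (fun i hi j hj => hKT _ (Finset.mem_image.2 ⟨(i, j), Finset.mk_mem_product hi hj, rfl⟩))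
    with hnar | hnar
  · have hswap : ∀ h : ℝ × ℝ → ℝ, ∫ z in Prod.swap ⁻¹' K, h z.swap = ∫ z in K, h z := fun h =>
      (Measure.measurePreserving_swap (μ := (volume : Measure ℝ)) (ν := (volume : Measure ℝ))
        ).setIntegral_preimage_emb MeasurableEquiv.prodComm.measurableEmbedding h K
    have hd : ∀ t y y', (t, y) ∈ Prod.swap ⁻¹' K → (t, y') ∈ Prod.swap ⁻¹' K →
        dist ((y, t) : ℝ × ℝ) (y', t) ≤ δ := by
      intro t y y' hy hy'
      rw [dist_prod_same_right, Real.dist_eq]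
      have h1 := hnar _ hy _ hy'
      have h2 := hnar _ hy' _ hy
      simp only [Prod.swap_prod_mk] at h1 h2
      exact abs_le.2 ⟨by linarith, by linarith⟩
    obtain ⟨a, ha, b, hb, ψ, h1, h2, h3, h4, h5⟩ := exists_concave_weight_of_section_oscillation
      (K := Prod.swap ⁻¹' K) (f := fun z => f z.swap) (g := fun z => g z.swap) (ε := ε)
      (hKo.preimage continuous_swap)
      (hKc.linear_preimage (LinearEquiv.prodComm ℝ ℝ ℝ).toLinearMap) (by
        have : Prod.swap ⁻¹' K = Prod.swap '' K := by
          rw [image_swap_eq_preimage_swap]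
        rw [this]
        exact (hKb.isCompact_closure.image continuous_swap).isBounded.subset
          (image_mono subset_closure)) (by fun_prop) (by fun_prop)
      (fun t y y' hy hy' => (hosc _ hy _ hy' (hd t y y' hy hy')).1)
      (fun t y y' hy hy' => (hosc _ hy _ hy' (hd t y y' hy hy')).2)
      (by rw [hswap fun z => f z - ε]; exact hfK) (by rw [hswap fun z => g z - ε]; exact hgK)
    exact ⟨a.swap, hKD ha, b.swap, hKD hb, ψ, h1, h2, h3, h4, h5⟩
  · have hd : ∀ t y y', (t, y) ∈ K → (t, y') ∈ K → dist ((t, y) : ℝ × ℝ) (t, y') ≤ δ := by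
      intro t y y' hy hy'
      rw [dist_prod_same_left, Real.dist_eq]
      exact (hnar t y y' hy hy').trans hqδ
    obtain ⟨a, ha, b, hb, h⟩ := exists_concave_weight_of_section_oscillation
      hKo hKc hKb hf hg (fun t y y' hy hy' => (hosc _ hy _ hy' (hd t y y' hy hy')).1)
      (fun t y y' hy hy' => (hosc _ hy _ hy' (hd t y y' hy hy')).2) hfK hgK
    exact ⟨a, hKD ha, b, hKD hb, h⟩

theorem insertNth_lineMap {n : ℕ} (s y y' : ℝ) (x x' : Fin n → ℝ) :
    (1 - s) • (0 : Fin (n + 1)).insertNth (α := fun _ => ℝ) y x +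
        s • (0 : Fin (n + 1)).insertNth (α := fun _ => ℝ) y' x' =
      (0 : Fin (n + 1)).insertNth (α := fun _ => ℝ) ((1 - s) * y + s * y')
        ((1 - s) • x + s • x') :=
  funext ((Fin.forall_iff_succAbove 0).2 ⟨by simp, fun i => by simp⟩)

theorem setIntegral_box_succ {n : ℕ} {R : ℝ} (hR : 0 < R) {f : (Fin (n + 1) → ℝ) → ℝ}
    (hf : Continuous f) :
    ∫ x in Icc (fun _ => -R) (fun _ => R), f x =
      ∫ x in Icc (fun _ : Fin n => -R) (fun _ => R), ∫ y in (-R)..R,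
        f ((0 : Fin (n + 1)).insertNth (α := fun _ => ℝ) y x) := by
  have hmp := (volume_preserving_piFinSuccAbove (fun _ : Fin (n + 1) => ℝ) 0).symm
  have hpre : (MeasurableEquiv.piFinSuccAbove (fun _ : Fin (n + 1) => ℝ) 0).symm ⁻¹'
      Icc (fun _ => -R) (fun _ => R) = Icc (-R) R ×ˢ Icc (fun _ : Fin n => -R) (fun _ => R) := by
    ext ⟨y, x⟩
    exact Fin.insertNth_mem_Icc
  rw [← hmp.setIntegral_preimage_emb (MeasurableEquiv.measurableEmbedding _) f, hpre,
    Measure.volume_eq_prod, ← setIntegral_prod_swap, setIntegral_prod]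
  · refine setIntegral_congr_fun measurableSet_Icc fun x _ => ?_
    rw [intervalIntegral.integral_of_le (by linarith), ← integral_Icc_eq_integral_Ioc]
    rfl
  · refine ContinuousOn.integrableOn_compact (isCompact_Icc.prod isCompact_Icc) ?_
    refine Continuous.continuousOn ?_
    exact hf.comp (Continuous.finInsertNth (A := fun _ : Fin (n + 1) => ℝ) 0 continuous_snd
      continuous_fst)

theorem exists_needle_pi (n : ℕ) {R : ℝ} (hR : 0 < R) : ∀ {f g : (Fin (n + 1) → ℝ) → ℝ},
    Continuous f → Continuous g → 0 < (∫ x in Icc (fun _ => -R) (fun _ => R), f x) →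
    0 < (∫ x in Icc (fun _ => -R) (fun _ => R), g x) →
    ∃ a ∈ Icc (fun _ : Fin (n + 1) => -R) (fun _ => R),
      ∃ b ∈ Icc (fun _ : Fin (n + 1) => -R) (fun _ => R), ∃ c d : ℝ,
      (∀ t ∈ Icc (0 : ℝ) 1, 0 < c + d * t) ∧
      0 < (∫ t in (0 : ℝ)..1, f ((1 - t) • a + t • b) * (c + d * t) ^ n) ∧
      0 < ∫ t in (0 : ℝ)..1, g ((1 - t) • a + t • b) * (c + d * t) ^ n := by
  induction n with
  | zero =>
    intro f g hf hg hfpos hgpos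
    have hle : -R ≤ R := by linarith
    have key : ∀ h : (Fin 1 → ℝ) → ℝ, Continuous h →
        0 < (∫ x in Icc (fun _ => -R) (fun _ => R), h x) →
        0 < ∫ t in (0 : ℝ)..1,
          h ((1 - t) • (fun _ => -R) + t • (fun _ => R)) * (1 + 0 * t) ^ 0 := by
      intro h hh hpos
      rw [setIntegral_box_succ hR hh] at hpos
      have huniq : ∀ x : Fin 0 → ℝ, x = 0 := fun x => Subsingleton.elim _ _
      have hbox : Icc (fun _ : Fin 0 => -R) (fun _ => R) = univ :=
        eq_univ_of_forall fun x => ⟨fun i => i.elim0, fun i => i.elim0⟩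
      simp only [huniq] at hpos
      rw [integral_const, smul_eq_mul] at hpos
      have hpos' := pos_of_mul_pos_right hpos measureReal_nonneg
      have e := intervalIntegral.smul_integral_comp_add_mul (a := 0) (b := 1)
        (fun y => h ((0 : Fin 1).insertNth (α := fun _ => ℝ) y 0)) (R - -R) (-R)
      rw [mul_zero, add_zero, mul_one, add_sub_cancel, smul_eq_mul] at e
      rw [← e] at hpos'
      refine (pos_of_mul_pos_right hpos' (by linarith)).trans_eq
        (intervalIntegral.integral_congr fun t _ => ?_)
      rw [pow_zero, mul_one]
      congr 1
      funext i
      have : i = 0 := Subsingleton.elim (α := Fin 1) _ _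
      subst this
      simp only [Pi.add_apply, Pi.smul_apply, smul_eq_mul, Fin.insertNth_apply_same]
      ring
    exact ⟨_, ⟨le_rfl, fun _ => hle⟩, _, ⟨fun _ => hle, le_rfl⟩, 1, 0, by simp, key f hf hfpos,
      key g hg hgpos⟩
  | succ n ih =>
    intro f g hf hg hfpos hgpos
    have hins : ∀ h : (Fin (n + 2) → ℝ) → ℝ, Continuous h →
        Continuous fun z : (Fin (n + 1) → ℝ) × ℝ =>
        h ((0 : Fin (n + 2)).insertNth (α := fun _ => ℝ) z.2 z.1) := fun h hh =>
      hh.comp (Continuous.finInsertNth 0 continuous_snd continuous_fst)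
    have hmarg : ∀ h : (Fin (n + 2) → ℝ) → ℝ, Continuous h → Continuous fun x : Fin (n + 1) → ℝ =>
        ∫ y in (-R)..R, h ((0 : Fin (n + 2)).insertNth (α := fun _ => ℝ) y x) := fun h hh =>
      intervalIntegral.continuous_parametric_intervalIntegral_of_continuous' (hins h hh) _ _
    rw [setIntegral_box_succ hR hf] at hfpos
    rw [setIntegral_box_succ hR hg] at hgpos
    obtain ⟨a, ha, b, hb, c, d, hcd, hfab, hgab⟩ := ih (hmarg f hf) (hmarg g hg) hfpos hgpos
    set F : ((Fin (n + 2) → ℝ) → ℝ) → ℝ × ℝ → ℝ := fun h z =>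
      h ((0 : Fin (n + 2)).insertNth (α := fun _ => ℝ) z.2 ((1 - z.1) • a + z.1 • b)) *
        (c + d * z.1) ^ n with hF
    have hFc : ∀ h, Continuous h → Continuous (F h) := fun h hh =>
      ((hins h hh).comp (by fun_prop : Continuous fun z : ℝ × ℝ =>
        ((1 - z.1) • a + z.1 • b, z.2))).mul (by fun_prop)
    have hFpos : ∀ h, Continuous h →
        0 < (∫ t in (0 : ℝ)..1, (∫ y in (-R)..R, h ((0 : Fin (n + 2)).insertNth (α := fun _ => ℝ) y
          ((1 - t) • a + t • b))) * (c + d * t) ^ n) →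
        0 < ∫ z in Ioo (0 : ℝ) 1 ×ˢ Ioo (-R) R, F h z := by
      intro h hh hpos
      rw [Measure.volume_eq_prod, setIntegral_prod]
      · rw [intervalIntegral.integral_of_le zero_le_one, integral_Ioc_eq_integral_Ioo] at hpos
        refine hpos.trans_eq (setIntegral_congr_fun measurableSet_Ioo fun t _ => ?_)
        rw [← integral_Ioc_eq_integral_Ioo, ← intervalIntegral.integral_of_le (by linarith),
          ← intervalIntegral.integral_mul_const]
      · exact ((hFc h hh).continuousOn.integrableOn_compact
          (isCompact_Icc.prod isCompact_Icc)).mono_set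
          (prod_mono Ioo_subset_Icc_self Ioo_subset_Icc_self)
    obtain ⟨⟨t₁, y₁⟩, h₁, ⟨t₂, y₂⟩, h₂, ψ, hψc, hψ0, hψ, hfψ, hgψ⟩ := exists_segment_concave_weight
      (hFc f hf) (hFc g hg) (hFpos f hf hfab) (hFpos g hg hgab)
    simp only [mem_prod, mem_Ioo] at h₁ h₂
    set X₁ : Fin (n + 2) → ℝ := (0 : Fin (n + 2)).insertNth (α := fun _ => ℝ) y₁
      ((1 - t₁) • a + t₁ • b) with hX₁
    set X₂ : Fin (n + 2) → ℝ := (0 : Fin (n + 2)).insertNth (α := fun _ => ℝ) y₂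
      ((1 - t₂) • a + t₂ • b) with hX₂
    set X : ℝ → Fin (n + 2) → ℝ := fun s => (1 - s) • X₁ + s • X₂ with hX
    set τ : ℝ → ℝ := fun s => (1 - s) * t₁ + s * t₂ with hτ
    have hτmem : ∀ s ∈ Icc (0 : ℝ) 1, τ s ∈ Icc (0 : ℝ) 1 := fun s hs =>
      convex_Icc (0 : ℝ) 1 ⟨h₁.1.1.le, h₁.1.2.le⟩ ⟨h₂.1.1.le, h₂.1.2.le⟩ (sub_nonneg.2 hs.2) hs.1
        (sub_add_cancel 1 s)
    have hFX : ∀ h s, F h ((1 - s) • (t₁, y₁) + s • (t₂, y₂)) = h (X s) * (c + d * τ s) ^ n := by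
      intro h s
      simp only [hF, hX, hX₁, hX₂, hτ, insertNth_lineMap, Prod.fst_add, Prod.snd_add, Prod.smul_fst,
        Prod.smul_snd, smul_eq_mul]
      congr 3
      module
    set φ : ℝ → ℝ := fun s => ((c + d * τ s) ^ n * ψ s) ^ ((n : ℝ) + 1)⁻¹ with hφ
    have hφc : Continuous φ := Continuous.rpow_const (by fun_prop) fun s => Or.inr (by positivity)
    have hl0 : ∀ s ∈ Icc (0 : ℝ) 1, 0 < c + d * τ s := fun s hs => hcd _ (hτmem s hs)
    have hφ0 : ∀ s ∈ Icc (0 : ℝ) 1, 0 < φ s := fun s hs =>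
      Real.rpow_pos_of_pos (mul_pos (pow_pos (hl0 s hs) n) (hψ0 s hs)) _
    have hφpow : ∀ s ∈ Icc (0 : ℝ) 1, φ s ^ (n + 1) = (c + d * τ s) ^ n * ψ s := fun s hs => by
      have := Real.rpow_inv_natCast_pow (n := n + 1)
        (mul_pos (pow_pos (hl0 s hs) n) (hψ0 s hs)).le (Nat.succ_ne_zero n)
      rw [Nat.cast_succ] at this
      exact this
    have hφconc : ConcaveOn ℝ (Icc 0 1) φ := by
      refine ⟨convex_Icc 0 1, fun s hs t ht p q hp hq hpq => ?_⟩
      simp only [hφ, smul_eq_mul]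
      refine geomMean_concave n (hl0 s hs) (hl0 t ht) (hψ0 s hs) (hψ0 t ht) hp hq hpq
        (le_of_eq ?_) (hψ.2 hs ht hp hq hpq)
      simp only [hτ]
      linear_combination (c + d * t₁) * hpq
    have hB : ∀ h, Continuous h →
        0 < (∫ s in (0 : ℝ)..1, F h ((1 - s) • (t₁, y₁) + s • (t₂, y₂)) * ψ s) →
        0 < ∫ s in (0 : ℝ)..1, h (X s) * φ s ^ (n + 1) := by
      intro h hh hpos
      convert hpos using 1
      refine intervalIntegral.integral_congr fun s hs => ?_
      rw [uIcc_of_le zero_le_one] at hs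
      simp only [hφpow s hs, hFX]
      ring
    have hXc : Continuous X := by fun_prop
    obtain ⟨α, β, c', d', hα, hαβ, hβ, hcd', hfX, hgX⟩ := exists_affine_pow_weight_of_concave n
      (hf.comp hXc) (hg.comp hXc) hφc hφ0 hφconc (hB f hf hfψ) (hB g hg hgψ)
    have hbox : Convex ℝ (Icc (fun _ : Fin (n + 2) => -R) (fun _ => R)) := convex_Icc _ _
    have hX₁box : X₁ ∈ Icc (fun _ : Fin (n + 2) => -R) (fun _ => R) :=
      Fin.insertNth_mem_Icc.2 ⟨⟨h₁.2.1.le, h₁.2.2.le⟩, convex_Icc _ _ ha hb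
        (sub_nonneg.2 h₁.1.2.le) h₁.1.1.le (sub_add_cancel 1 t₁)⟩
    have hX₂box : X₂ ∈ Icc (fun _ : Fin (n + 2) => -R) (fun _ => R) :=
      Fin.insertNth_mem_Icc.2 ⟨⟨h₂.2.1.le, h₂.2.2.le⟩, convex_Icc _ _ ha hb
        (sub_nonneg.2 h₂.1.2.le) h₂.1.1.le (sub_add_cancel 1 t₂)⟩
    have hXbox : ∀ s, 0 ≤ s → s ≤ 1 → X s ∈ Icc (fun _ : Fin (n + 2) => -R) (fun _ => R) :=
      fun s h0 h1 => hbox hX₁box hX₂box (sub_nonneg.2 h1) h0 (sub_add_cancel 1 s)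
    have hXX : ∀ s : ℝ, (1 - s) • X α + s • X β = X (α + (β - α) * s) := fun s => by
      simp only [hX]
      module
    exact ⟨X α, hXbox α hα (hαβ.trans hβ), X β, hXbox β (hα.trans hαβ) hβ, c', d', hcd',
      by simpa only [hXX, Function.comp_apply] using hfX,
      by simpa only [hXX, Function.comp_apply] using hgX⟩

/-- The infimal convolution of `u` over `C` with `k` times the distance. -/
noncomputable def lipschitzRegularization {X : Type*} [PseudoMetricSpace X] (u : X → ℝ) (C : Set X)
    (k : ℕ) (x : X) : ℝ :=
  ⨅ y : C, (u y + k * dist x y)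

section LipschitzRegularization

variable {X : Type*} [PseudoMetricSpace X] {u : X → ℝ} {C : Set X} {m : ℝ}

theorem bddBelow_range_lipschitzRegularization (hm : ∀ y ∈ C, m ≤ u y) (k : ℕ) (x : X) :
    BddBelow (range fun y : C => u y + k * dist x y) := by
  refine ⟨m, ?_⟩
  rintro _ ⟨y, rfl⟩
  have : 0 ≤ (k : ℝ) * dist x y := by positivity
  have := hm y y.2
  simp only
  linarith

theorem lipschitzRegularization_le (hm : ∀ y ∈ C, m ≤ u y) (k : ℕ) {x : X} (hx : x ∈ C) :
    lipschitzRegularization u C k x ≤ u x :=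
  (ciInf_le (bddBelow_range_lipschitzRegularization hm k x) ⟨x, hx⟩).trans_eq (by simp)

theorem le_lipschitzRegularization (hC : C.Nonempty) (hm : ∀ y ∈ C, m ≤ u y) (k : ℕ) (x : X) :
    m ≤ lipschitzRegularization u C k x := by
  have := hC.to_subtype
  refine le_ciInf fun y => ?_
  have : 0 ≤ (k : ℝ) * dist x y := by positivity
  linarith [hm y y.2]

theorem continuous_lipschitzRegularization (hC : C.Nonempty) (hm : ∀ y ∈ C, m ≤ u y) (k : ℕ) :
    Continuous (lipschitzRegularization u C k) := by
  have := hC.to_subtype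
  refine (LipschitzWith.of_le_add_mul (k : NNReal) fun x y => ?_).continuous
  rw [← sub_le_iff_le_add]
  refine le_ciInf fun z => ?_
  have h1 : lipschitzRegularization u C k x ≤ u z + k * dist x z :=
    ciInf_le (bddBelow_range_lipschitzRegularization hm k x) z
  have h2 := mul_le_mul_of_nonneg_left (dist_triangle x y z) (Nat.cast_nonneg (α := ℝ) k)
  simp only [NNReal.coe_natCast]
  linarith

theorem tendsto_lipschitzRegularization (hu : LowerSemicontinuous u) (hm : ∀ y ∈ C, m ≤ u y)
    {x : X} (hx : x ∈ C) :
    Filter.Tendsto (fun k => lipschitzRegularization u C k x) Filter.atTop (nhds (u x)) := by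
  have : Nonempty C := ⟨⟨x, hx⟩⟩
  rw [tendsto_order]
  refine ⟨fun b hb => ?_, fun b hb => .of_forall fun k =>
    (lipschitzRegularization_le hm k hx).trans_lt hb⟩
  obtain ⟨b', hb', hb'u⟩ := exists_between hb
  obtain ⟨δ, hδ, hball⟩ := Metric.eventually_nhds_iff.1 (hu x b' hb'u)
  obtain ⟨k₀, hk₀⟩ := exists_nat_ge ((u x - m) / δ)
  filter_upwards [Filter.eventually_ge_atTop k₀] with k hk
  refine hb'.trans_le (le_ciInf fun y => ?_)
  have hk' : (0 : ℝ) ≤ k := Nat.cast_nonneg k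
  rcases lt_or_ge (dist (y : X) x) δ with h | h
  · have := hball h
    have : 0 ≤ (k : ℝ) * dist x y := by positivity
    linarith
  · rw [div_le_iff₀ hδ] at hk₀
    have hkk : (k₀ : ℝ) ≤ k := Nat.cast_le.2 hk
    rw [dist_comm] at h
    have h1 : (k₀ : ℝ) * δ ≤ k * dist x y := mul_le_mul hkk h hδ.le hk'
    linarith [hm y y.2]

end LipschitzRegularization

theorem exists_continuous_minorant_setIntegral_pos {X : Type*} [PseudoMetricSpace X]
    [MeasurableSpace X] [BorelSpace X] [SecondCountableTopology X] {μ : Measure X}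
    [IsFiniteMeasureOnCompacts μ] {u : X → ℝ} (hu : LowerSemicontinuous u) {C : Set X}
    (hC : IsCompact C) (hCm : MeasurableSet C) (hint : IntegrableOn u C μ)
    (hpos : 0 < ∫ x in C, u x ∂μ) :
    ∃ w : X → ℝ, Continuous w ∧ (∀ x ∈ C, w x ≤ u x) ∧ 0 < ∫ x in C, w x ∂μ := by
  have hne : C.Nonempty := by
    rw [nonempty_iff_ne_empty]
    rintro rfl
    simp at hpos
  obtain ⟨x₀, -, hx₀⟩ := (hu.lowerSemicontinuousOn C).exists_isMinOn hne hC
  have hm : ∀ y ∈ C, u x₀ ≤ u y := fun y hy => hx₀ hy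
  have hlim : Filter.Tendsto (fun k => ∫ x in C, lipschitzRegularization u C k x ∂μ) Filter.atTop
      (nhds (∫ x in C, u x ∂μ)) := by
    refine tendsto_integral_of_dominated_convergence (fun x => |u x| + |u x₀|)
      (fun k => (continuous_lipschitzRegularization hne hm k).aestronglyMeasurable)
      (hint.abs.add (integrableOn_const hC.measure_lt_top.ne)) (fun k => ?_) ?_
    · filter_upwards [ae_restrict_mem hCm] with x hx
      rw [Real.norm_eq_abs, abs_le]
      have h1 := lipschitzRegularization_le hm k hx
      have h2 := le_lipschitzRegularization hne hm k x
      constructor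
      · linarith [neg_abs_le (u x₀), abs_nonneg (u x)]
      · linarith [le_abs_self (u x), abs_nonneg (u x₀)]
    · filter_upwards [ae_restrict_mem hCm] with x hx
      exact tendsto_lipschitzRegularization hu hm hx
  obtain ⟨k, hk⟩ := (hlim.eventually (lt_mem_nhds hpos)).exists
  exact ⟨_, continuous_lipschitzRegularization hne hm k,
    fun x hx => lipschitzRegularization_le hm k hx, hk⟩

section NeedleIntegrability

open Module
open scoped ENNReal

variable {E : Type*} [NormedAddCommGroup E] [NormedSpace ℝ E] [FiniteDimensional ℝ E]
  [MeasurableSpace E] [BorelSpace E] (μ : Measure E) [μ.IsAddHaarMeasure]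

theorem lintegral_comp_smul_add_le {g : E → ℝ≥0∞} (hg : Measurable g) {s : ℝ} (hs : 1 / 2 ≤ s)
    (c : E) : ∫⁻ x, g (s • x + c) ∂μ ≤ 2 ^ finrank ℝ E * ∫⁻ x, g x ∂μ := by
  have hs0 : s ≠ 0 := by linarith
  have hmap : ∫⁻ x, g (s • x + c) ∂μ = ∫⁻ y, g (y + c) ∂(μ.map (s • ·)) :=
    (lintegral_map (hg.comp (measurable_add_const c)) (measurable_const_smul s)).symm
  rw [hmap, Measure.map_addHaar_smul μ hs0, lintegral_smul_measure,
    lintegral_add_right_eq_self g c, smul_eq_mul]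
  gcongr
  rw [← ENNReal.ofReal_ofNat 2, ← ENNReal.ofReal_pow (by norm_num)]
  apply ENNReal.ofReal_le_ofReal
  rw [← inv_pow, abs_of_nonneg (by positivity)]
  gcongr
  rw [inv_le_comm₀ (by linarith) (by norm_num)]
  linarith

theorem lintegral_prod_comp_lineMap_le {g : E → ℝ≥0∞} (hg : Measurable g) (K : Set E)
    [IsFiniteMeasure (μ.restrict K)] (t : ℝ) :
    ∫⁻ p, g ((1 - t) • p.1 + t • p.2) ∂((μ.restrict K).prod (μ.restrict K)) ≤
      2 ^ finrank ℝ E * (∫⁻ x, g x ∂μ) * μ K := by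
  rcases le_total t (1 / 2) with ht | ht
  · rw [lintegral_prod_symm' _ (by fun_prop)]
    calc _ ≤ ∫⁻ _ in K, 2 ^ finrank ℝ E * (∫⁻ x, g x ∂μ) ∂μ := by
          refine lintegral_mono fun b => (setLIntegral_le_lintegral K _).trans ?_
          have h1t : 1 / 2 ≤ 1 - t := by linarith
          exact lintegral_comp_smul_add_le μ hg h1t (t • b)
      _ = _ := by rw [lintegral_const, Measure.restrict_apply_univ]
  · rw [lintegral_prod _ (by fun_prop)]
    calc _ ≤ ∫⁻ _ in K, 2 ^ finrank ℝ E * (∫⁻ x, g x ∂μ) ∂μ := by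
          refine lintegral_mono fun a => (setLIntegral_le_lintegral K _).trans ?_
          simp only [add_comm ((1 - t) • a)]
          exact lintegral_comp_smul_add_le μ hg ht _
      _ = _ := by rw [lintegral_const, Measure.restrict_apply_univ]

theorem ae_integrableOn_comp_lineMap {u : E → ℝ} (hu : Measurable u) (hui : Integrable u μ)
    (K : Set E) [IsFiniteMeasure (μ.restrict K)] :
    ∀ᵐ p : E × E ∂((μ.restrict K).prod (μ.restrict K)),
      IntegrableOn (fun t : ℝ => u ((1 - t) • p.1 + t • p.2)) (Ioo (0 : ℝ) 1) volume := by
  have hmeas : Measurable fun q : (E × E) × ℝ =>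
      ‖u ((1 - q.2) • q.1.1 + q.2 • q.1.2)‖ₑ := by fun_prop
  have hfin : ∫⁻ p, (∫⁻ t in Ioo (0 : ℝ) 1, ‖u ((1 - t) • p.1 + t • p.2)‖ₑ)
      ∂((μ.restrict K).prod (μ.restrict K)) ≠ ∞ := by
    rw [lintegral_lintegral_swap hmeas.aemeasurable]
    refine ne_top_of_le_ne_top (b := ∫⁻ _ in Ioo (0 : ℝ) 1,
      2 ^ finrank ℝ E * (∫⁻ x, ‖u x‖ₑ ∂μ) * μ K) ?_
      (lintegral_mono fun t => lintegral_prod_comp_lineMap_le μ hu.enorm K t)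
    have hK : μ K ≠ ∞ := by
      rw [← Measure.restrict_apply_univ]; exact measure_ne_top _ _
    rw [lintegral_const, Measure.restrict_apply_univ, Real.volume_Ioo]
    exact ENNReal.mul_ne_top (ENNReal.mul_ne_top (ENNReal.mul_ne_top (by simp) hui.2.ne) hK)
      ENNReal.ofReal_ne_top
  filter_upwards [ae_lt_top hmeas.lintegral_prod_right' hfin] with p hp
  exact ⟨Measurable.aestronglyMeasurable (by fun_prop), hp⟩

end NeedleIntegrability

theorem exists_pos_setIntegral_closedBall_pos {X : Type*} [PseudoMetricSpace X] [MeasurableSpace X]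
    [OpensMeasurableSpace X] {μ : Measure X} {u v : X → ℝ} (hui : Integrable u μ)
    (hvi : Integrable v μ) (hu : 0 < ∫ x, u x ∂μ) (hv : 0 < ∫ x, v x ∂μ) (x₀ : X) :
    ∃ R : ℝ, 0 < R ∧ (0 < ∫ x in Metric.closedBall x₀ R, u x ∂μ) ∧
      0 < ∫ x in Metric.closedBall x₀ R, v x ∂μ := by
  have hcover : AECover μ Filter.atTop fun R : ℝ => Metric.closedBall x₀ R :=
    aecover_closedBall Filter.tendsto_id
  have h1 := (hcover.integral_tendsto_of_countably_generated hui).eventually_const_lt hu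
  have h2 := (hcover.integral_tendsto_of_countably_generated hvi).eventually_const_lt hv
  exact ((Filter.eventually_gt_atTop 0).and (h1.and h2)).exists

theorem setIntegral_comp_lineMap_mul_pos_of_le {E : Type*} [NormedAddCommGroup E]
    [NormedSpace ℝ E] {K : Set E} (hK : Convex ℝ K) {u w : E → ℝ} (hw : Continuous w)
    (hwu : ∀ x ∈ K, w x ≤ u x) {a b : E} (ha : a ∈ K) (hb : b ∈ K) {l : ℝ → ℝ}
    (hl : Continuous l) (hl0 : ∀ t ∈ Icc (0 : ℝ) 1, 0 ≤ l t)
    (hui : IntegrableOn (fun t : ℝ => u ((1 - t) • a + t • b)) (Ioo 0 1))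
    (hpos : 0 < ∫ t in (0 : ℝ)..1, w ((1 - t) • a + t • b) * l t) :
    0 < ∫ t in Ioo (0 : ℝ) 1, u ((1 - t) • a + t • b) * l t := by
  rw [intervalIntegral.integral_of_le zero_le_one, integral_Ioc_eq_integral_Ioo] at hpos
  refine hpos.trans_le (setIntegral_mono_on ?_ ?_ measurableSet_Ioo fun t ht => ?_)
  · refine IntegrableOn.mono_set (t := Icc 0 1) ?_ Ioo_subset_Icc_self
    exact Continuous.integrableOn_Icc (by fun_prop)
  · obtain ⟨M, hM⟩ := isCompact_Icc.exists_bound_of_continuousOn (hl.continuousOn (s := Icc 0 1))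
    refine Integrable.mul_bdd (c := M) hui hl.aestronglyMeasurable ?_
    exact (ae_restrict_iff' measurableSet_Ioo).2
      (Filter.Eventually.of_forall fun t ht => hM t (Ioo_subset_Icc_self ht))
  · refine mul_le_mul_of_nonneg_right (hwu _ ?_) (hl0 t (Ioo_subset_Icc_self ht))
    exact hK ha hb (by linarith [ht.2]) ht.1.le (by ring)

theorem exists_needle_pi_of_lowerSemicontinuous (n : ℕ) {u v : (Fin (n + 1) → ℝ) → ℝ}
    (hu : LowerSemicontinuous u) (hv : LowerSemicontinuous v)
    (hui : Integrable u) (hvi : Integrable v) (hupos : 0 < ∫ x, u x) (hvpos : 0 < ∫ x, v x) :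
    ∃ (a b : Fin (n + 1) → ℝ) (c d : ℝ),
      (∀ t ∈ Icc (0 : ℝ) 1, 0 < c + d * t) ∧
      (0 < ∫ t in Ioo (0 : ℝ) 1, u ((1 - t) • a + t • b) * (c + d * t) ^ n) ∧
      (0 < ∫ t in Ioo (0 : ℝ) 1, v ((1 - t) • a + t • b) * (c + d * t) ^ n) := by
  obtain ⟨R, hR, huR, hvR⟩ := exists_pos_setIntegral_closedBall_pos hui hvi hupos hvpos 0
  set K : Set (Fin (n + 1) → ℝ) := Metric.closedBall 0 R with hKdef
  have hKc : IsCompact K := isCompact_closedBall 0 R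
  have hKm : MeasurableSet K := hKc.measurableSet
  have hKI : K = Icc (fun _ => -R) (fun _ => R) := by
    ext x
    simp [hKdef, pi_norm_le_iff_of_nonneg hR.le, abs_le, Pi.le_def, forall_and]
  obtain ⟨f, hf, hfu, hfpos⟩ :=
    exists_continuous_minorant_setIntegral_pos hu hKc hKm hui.integrableOn huR
  obtain ⟨g, hg, hgv, hgpos⟩ :=
    exists_continuous_minorant_setIntegral_pos hv hKc hKm hvi.integrableOn hvR
  rw [hKI] at hfpos hgpos
  obtain ⟨a₀, ha₀, b₀, hb₀, c, d, hl, hfl, hgl⟩ := exists_needle_pi n hR hf hg hfpos hgpos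
  rw [← hKI] at ha₀ hb₀
  have hcont : ∀ {w : (Fin (n + 1) → ℝ) → ℝ}, Continuous w →
      Continuous fun p : (Fin (n + 1) → ℝ) × (Fin (n + 1) → ℝ) =>
        ∫ t in (0 : ℝ)..1, w ((1 - t) • p.1 + t • p.2) * (c + d * t) ^ n := fun hw =>
    intervalIntegral.continuous_parametric_intervalIntegral_of_continuous' (by fun_prop) 0 1
  have hopen := ((isOpen_Ioi (a := 0)).preimage (hcont hf)).inter
    ((isOpen_Ioi (a := 0)).preimage (hcont hg))
  have hball : (a₀, b₀) ∈ closure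
      (Metric.ball (0 : Fin (n + 1) → ℝ) R ×ˢ Metric.ball (0 : Fin (n + 1) → ℝ) R) := by
    rw [closure_prod_eq, closure_ball _ hR.ne']
    exact ⟨ha₀, hb₀⟩
  have : IsFiniteMeasure ((volume : Measure (Fin (n + 1) → ℝ)).restrict K) :=
    isFiniteMeasure_restrict.2 hKc.measure_lt_top.ne
  have hgood := (ae_integrableOn_comp_lineMap volume hu.measurable hui K).and
    (ae_integrableOn_comp_lineMap volume hv.measurable hvi K)
  rw [Measure.prod_restrict, ae_restrict_iff' (hKm.prod hKm)] at hgood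
  obtain ⟨⟨a, b⟩, ⟨⟨hfab, hgab⟩, hab⟩, hint⟩ :=
    (Measure.dense_of_ae hgood).inter_open_nonempty _
      (hopen.inter (Metric.isOpen_ball.prod Metric.isOpen_ball))
      (mem_closure_iff.1 hball _ hopen ⟨hfl, hgl⟩)
  have ha : a ∈ K := Metric.ball_subset_closedBall hab.1
  have hb : b ∈ K := Metric.ball_subset_closedBall hab.2
  obtain ⟨hua, hva⟩ := hint ⟨ha, hb⟩
  have hKconv : Convex ℝ K := convex_closedBall 0 R
  refine ⟨a, b, c, d, hl, ?_, ?_⟩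
  · exact setIntegral_comp_lineMap_mul_pos_of_le hKconv hf hfu ha hb (by fun_prop)
      (fun t ht => pow_nonneg (hl t ht).le n) hua hfab
  · exact setIntegral_comp_lineMap_mul_pos_of_le hKconv hg hgv ha hb (by fun_prop)
      (fun t ht => pow_nonneg (hl t ht).le n) hva hgab

/-- **Localization Lemma** (Lovász–Simonovits).
If `u, v : ℝⁿ → ℝ` are lower semicontinuous integrable functions with positive Lebesgue
integrals, then there are points `a, b ∈ ℝⁿ` and an affine function `l(t) = c + d·t`,
strictly positive on `(0,1)`, such that the one-dimensional integrals
`∫₀¹ u((1-t)a + tb) l(t)^{n-1} dt` and `∫₀¹ v((1-t)a + tb) l(t)^{n-1} dt` are positive. -/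
theorem localization_lemma (n : ℕ) (hn : 1 ≤ n)
    (u v : EuclideanSpace ℝ (Fin n) → ℝ)
    (hu : LowerSemicontinuous u) (hv : LowerSemicontinuous v)
    (hui : Integrable u volume) (hvi : Integrable v volume)
    (hupos : 0 < ∫ x, u x) (hvpos : 0 < ∫ x, v x) :
    ∃ (a b : EuclideanSpace ℝ (Fin n)) (c d : ℝ),
      (∀ t ∈ Ioo (0 : ℝ) 1, 0 < c + d * t) ∧
      (0 < ∫ t in Ioo (0 : ℝ) 1, u ((1 - t) • a + t • b) * (c + d * t) ^ (n - 1)) ∧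
      (0 < ∫ t in Ioo (0 : ℝ) 1, v ((1 - t) • a + t • b) * (c + d * t) ^ (n - 1)) := by
  obtain ⟨m, rfl⟩ : ∃ m, n = m + 1 := ⟨n - 1, by omega⟩
  have hvol := PiLp.volume_preserving_toLp (Fin (m + 1))
  have hemb := (MeasurableEquiv.toLp 2 (Fin (m + 1) → ℝ)).measurableEmbedding
  have hcont : Continuous (WithLp.toLp 2 : (Fin (m + 1) → ℝ) → EuclideanSpace ℝ (Fin (m + 1))) :=
    PiLp.continuous_toLp 2 _
  obtain ⟨a, b, c, d, hl, h1, h2⟩ := exists_needle_pi_of_lowerSemicontinuous m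
    (hu.comp hcont) (hv.comp hcont)
    ((hvol.integrable_comp_emb hemb).2 hui) ((hvol.integrable_comp_emb hemb).2 hvi)
    ((hvol.integral_comp hemb u).symm ▸ hupos) ((hvol.integral_comp hemb v).symm ▸ hvpos)
  exact ⟨WithLp.toLp 2 a, WithLp.toLp 2 b, c, d, fun t ht => hl t (Ioo_subset_Icc_self ht), h1, h2⟩
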